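/- arXiv:2306.00878 — 13 statements merged into one kernel-verified Lean document; each statement's English description precedes it below -/
import Mathlib

section
/- Let Γ be strongly regular with parameters (n,k,μ,ν) with 1 ≤ k and k + 2 ≤ n, and let r, s be real numbers with r > s each satisfying x² = (μ - ν)·x + (k - ν) (parameters cast to ℝ). Then 0 ≤ r ≤ k and s ≤ -1. -/
namespace SimpleGraph.IsSRGWith

variable {V : Type*} [Fintype V] {G : SimpleGraph V} [DecidableRel G.Adj]
  {n k μ ν : ℕ}

/-- In a nonempty strongly regular graph of positive degree, adjacent vertices have fewer than `k`
common neighbours. -/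
theorem adj_param_lt_degree [Nonempty V] (h : G.IsSRGWith n k μ ν) (hk : 0 < k) : μ < k := by
  obtain ⟨v⟩ := ‹Nonempty V›
  have hv := h.regular v
  obtain ⟨w, hvw⟩ := (G.degree_pos_iff_exists_adj v).1 (hv ▸ hk)
  rw [← h.of_adj v w hvw, ← hv]
  exact hvw.card_commonNeighbors_lt_degree

/-- In a strongly regular graph of degree `k ≤ n - 2`, distinct non-adjacent vertices have at most
`k` common neighbours. -/
theorem not_adj_param_le_degree [DecidableEq V] (h : G.IsSRGWith n k μ ν) (hn : k + 2 ≤ n) : ν ≤ k := by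
  have hcard := h.card
  obtain ⟨v⟩ : Nonempty V := Fintype.card_pos_iff.1 (by omega)
  have hv := h.regular v
  obtain ⟨w, hw⟩ : ∃ w, w ∉ insert v (G.neighborFinset v) := by
    by_contra! hall
    have hle := Finset.card_insert_le v (G.neighborFinset v)
    rw [Finset.eq_univ_of_forall hall, Finset.card_univ, card_neighborFinset_eq_degree] at hle
    omega
  simp only [Finset.mem_insert, mem_neighborFinset, not_or] at hw
  rw [← h.of_not_adj (Ne.symm hw.1) hw.2, ← hv]
  exact G.card_commonNeighbors_le_degree_left v w

end SimpleGraph.IsSRGWith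

theorem srg_eigenvalue_bounds {n k μ ν : ℕ} (Γ : SimpleGraph (Fin n)) [DecidableRel Γ.Adj]
    (h : Γ.IsSRGWith n k μ ν) (hk : 1 ≤ k) (hn : k + 2 ≤ n)
    (r s : ℝ)
    (hr : r ^ 2 = ((μ : ℝ) - (ν : ℝ)) * r + ((k : ℝ) - (ν : ℝ)))
    (hs : s ^ 2 = ((μ : ℝ) - (ν : ℝ)) * s + ((k : ℝ) - (ν : ℝ)))
    (hrs : r > s) :
    0 ≤ r ∧ r ≤ (k : ℝ) ∧ s ≤ -1 := by
  have : Nonempty (Fin n) := ⟨⟨0, by omega⟩⟩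
  have hμ : (μ : ℝ) + 1 ≤ k := by exact_mod_cast h.adj_param_lt_degree hk
  have hν : (ν : ℝ) ≤ k := by exact_mod_cast h.not_adj_param_le_degree hn
  have hk' : (1 : ℝ) ≤ k := by exact_mod_cast hk
  have hν0 : (0 : ℝ) ≤ ν := ν.cast_nonneg
  have hsum : r + s = μ - ν :=
    mul_left_cancel₀ (sub_ne_zero.2 hrs.ne') (by linear_combination hr - hs)
  have hprod : r * s = ν - k := by linear_combination r * hsum - hr
  have hr0 : 0 ≤ r := by
    by_contra! hneg
    nlinarith [mul_pos_of_neg_of_neg hneg (hrs.trans hneg)]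
  have hs1 : s ≤ -1 := by
    by_contra! hlt
    have : (r + 1) * (s + 1) = μ + 1 - k := by linear_combination hprod + hsum
    nlinarith [mul_pos (show 0 < r + 1 by linarith) (show 0 < s + 1 by linarith)]
  refine ⟨hr0, ?_, hs1⟩
  have hval : (k - r) * (k - s) = k * (k - (μ + 1)) + ν * (k + 1) := by
    linear_combination hprod - k * hsum
  have hnonneg : 0 ≤ (k - r) * (k - s) := by
    rw [hval]
    exact add_nonneg (mul_nonneg (by linarith) (by linarith)) (by positivity)
  linarith [nonneg_of_mul_nonneg_left hnonneg (by linarith : 0 < k - s)]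
end

section
/- Let Γ be strongly regular with parameters (n,k,μ,ν) with 1 ≤ k and k + 2 ≤ n, let ℓ = n - k - 1, and let r, s be real numbers with r > s each satisfying x² = (μ - ν)·x + (k - ν) (parameters cast to ℝ). Then 0 ≤ -1 - s ≤ ℓ, and k + r·s ≥ 0 ≥ 1 + r + s + r·s. -/
namespace SimpleGraph

variable {V : Type*} [Fintype V] {G : SimpleGraph V} [DecidableRel G.Adj] {n k μ ν : ℕ}

theorem IsSRGWith.exists_adj (h : G.IsSRGWith n k μ ν) (hk : 0 < k) (hn : 0 < n) :
    ∃ v w, G.Adj v w := by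
  rw [← h.card, Fintype.card_pos_iff] at hn
  obtain ⟨v⟩ := hn
  have hd : 0 < G.degree v := by rwa [h.regular.degree_eq]
  obtain ⟨w, hw⟩ := (G.degree_pos_iff_exists_adj v).1 hd
  exact ⟨v, w, hw⟩

theorem IsSRGWith.lt_degree_of_adj (h : G.IsSRGWith n k μ ν) {v w : V} (ha : G.Adj v w) :
    μ < k := by
  classical
  have := ha.card_commonNeighbors_lt_degree
  rwa [h.of_adj v w ha, h.regular.degree_eq] at this

theorem IsSRGWith.two_mul_le_of_adj (h : G.IsSRGWith n k μ ν) {v w : V} (ha : G.Adj v w) :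
    2 * k ≤ n + μ := by
  classical
  have hu := h.card_neighborFinset_union_of_adj ha
  have hc := Finset.card_le_univ (G.neighborFinset v ∪ G.neighborFinset w)
  rw [hu, h.card] at hc
  omega

end SimpleGraph

theorem srg_eigenvalue_bounds' {n k μ ν : ℕ} (Γ : SimpleGraph (Fin n)) [DecidableRel Γ.Adj]
    (h : Γ.IsSRGWith n k μ ν) (hk : 1 ≤ k) (hn : k + 2 ≤ n)
    (ℓ r s : ℝ) (hℓ : ℓ = (n : ℝ) - (k : ℝ) - 1)
    (hr : r ^ 2 = ((μ : ℝ) - (ν : ℝ)) * r + ((k : ℝ) - (ν : ℝ)))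
    (hs : s ^ 2 = ((μ : ℝ) - (ν : ℝ)) * s + ((k : ℝ) - (ν : ℝ)))
    (hrs : r > s) :
    (0 ≤ -1 - s ∧ -1 - s ≤ ℓ) ∧ ((k : ℝ) + r * s ≥ 0 ∧ (0 : ℝ) ≥ 1 + r + s + r * s) := by
  obtain ⟨v, w, ha⟩ := h.exists_adj hk (by omega)
  have hμ : (μ : ℝ) + 1 ≤ k := by exact_mod_cast h.lt_degree_of_adj ha
  have hcard : 2 * (k : ℝ) ≤ n + μ := by exact_mod_cast h.two_mul_le_of_adj ha
  have hparam : (k : ℝ) * (k - μ - 1) = (n - k - 1) * ν := by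
    have hp := h.param_eq Γ (by omega)
    have hlt := h.lt_degree_of_adj ha
    obtain ⟨a, rfl⟩ := Nat.exists_eq_add_of_le hn
    obtain ⟨b, rfl⟩ := Nat.exists_eq_add_of_lt hlt
    rw [show μ + b + 1 - μ - 1 = b by omega,
      show μ + b + 1 + 2 + a - (μ + b + 1) - 1 = a + 1 by omega] at hp
    have hp' : ((μ : ℝ) + b + 1) * b = (a + 1) * ν := by exact_mod_cast hp
    push_cast
    linear_combination hp'
  have hsum : r + s = μ - ν :=
    mul_left_cancel₀ (sub_ne_zero.2 hrs.ne') (by linear_combination hr - hs)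
  have hprod : r * s = ν - k := by linear_combination r * hsum - hr
  have hν : (0 : ℝ) ≤ ν := ν.cast_nonneg
  have hn' : (k : ℝ) + 2 ≤ n := by exact_mod_cast hn
  have hs1 : s ≤ -1 := by
    by_contra! hlt
    nlinarith [mul_pos (show 0 < 1 + r by linarith) (show 0 < 1 + s by linarith)]
  have hr1 : -1 ≤ r := by
    by_contra! hlt
    nlinarith [mul_pos (show 0 < -1 - r by linarith) (show 0 < -1 - s by linarith)]
  have hcompl : ((n : ℝ) - k + r) * (n - k + s) = n * (n + μ - 2 * k) := by
    linear_combination ((n : ℝ) - k) * hsum + hprod + hparam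
  have hnonneg : 0 ≤ (n : ℝ) - k + s := by
    refine nonneg_of_mul_nonneg_right (a := (n : ℝ) - k + r) ?_ (by linarith)
    rw [hcompl]
    exact mul_nonneg n.cast_nonneg (by linarith)
  refine ⟨⟨by linarith, by linarith⟩, by linarith, by linarith⟩
end

section
/- Let Γ be strongly regular with parameters (n,k,μ,ν) with 1 ≤ k and k + 2 ≤ n, let ℓ = n - k - 1, and let r, s be real numbers with r > s each satisfying x² = (μ - ν)·x + (k - ν) (parameters cast to ℝ). Then ℓ + (1 + r + s + r·s) ≥ 0 and ℓ - 1 + r·s ≥ 0. -/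
namespace SimpleGraph.IsSRGWith

open Finset

variable {V : Type*} [Fintype V] [DecidableEq V] {G : SimpleGraph V} [DecidableRel G.Adj]
  {n k l m : ℕ}

theorem two_mul_degree_le_of_adj (h : G.IsSRGWith n k l m) {v w : V} (ha : G.Adj v w) :
    2 * k ≤ n + l := by
  have hu := h.card_neighborFinset_union_of_adj ha
  have hle := card_le_univ (G.neighborFinset v ∪ G.neighborFinset w)
  rw [h.card] at hle
  omega

theorem two_mul_degree_add_two_le_of_not_adj (h : G.IsSRGWith n k l m) {v w : V} (hne : v ≠ w)
    (ha : ¬G.Adj v w) : 2 * k + 2 ≤ n + m := by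
  have hu := h.card_neighborFinset_union_of_not_adj hne ha
  have hd : Disjoint (G.neighborFinset v ∪ G.neighborFinset w) {v, w} := by
    have ha' : ¬G.Adj w v := fun hwv ↦ ha hwv.symm
    simp [ha, ha']
  have hle := card_le_univ ((G.neighborFinset v ∪ G.neighborFinset w) ∪ {v, w})
  rw [card_union_of_disjoint hd, card_pair hne, h.card] at hle
  omega

end SimpleGraph.IsSRGWith

theorem srg_structure_const_bounds {n k μ ν : ℕ} (Γ : SimpleGraph (Fin n)) [DecidableRel Γ.Adj]
    (h : Γ.IsSRGWith n k μ ν) (hk : 1 ≤ k) (hn : k + 2 ≤ n)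
    (ℓ r s : ℝ) (hℓ : ℓ = (n : ℝ) - (k : ℝ) - 1)
    (hr : r ^ 2 = ((μ : ℝ) - (ν : ℝ)) * r + ((k : ℝ) - (ν : ℝ)))
    (hs : s ^ 2 = ((μ : ℝ) - (ν : ℝ)) * s + ((k : ℝ) - (ν : ℝ)))
    (hrs : r > s) :
    ℓ + (1 + r + s + r * s) ≥ 0 ∧ ℓ - 1 + r * s ≥ 0 := by
  have hsum : r + s = (μ : ℝ) - ν :=
    mul_left_cancel₀ (sub_ne_zero.mpr hrs.ne') (by linear_combination hr - hs)
  have hprod : r * s = (ν : ℝ) - k := by linear_combination r * hsum - hr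
  let v : Fin n := ⟨0, by omega⟩
  obtain ⟨w, hw⟩ : ∃ w, Γ.Adj v w := by
    rw [← Γ.degree_pos_iff_exists_adj, h.regular.degree_eq]
    exact hk
  obtain ⟨u, hu⟩ : ∃ u, Γᶜ.Adj v u := by
    rw [← Γᶜ.degree_pos_iff_exists_adj, h.compl.regular.degree_eq]
    omega
  rw [SimpleGraph.compl_adj] at hu
  have hadj : (2 * k : ℝ) ≤ n + μ := mod_cast h.two_mul_degree_le_of_adj hw
  have hnadj : (2 * k + 2 : ℝ) ≤ n + ν :=
    mod_cast h.two_mul_degree_add_two_le_of_not_adj hu.1 hu.2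
  constructor <;> linarith
end

section
/- For every strongly regular graph Γ with parameters (n,k,μ,ν), the six matrices {A₀⊗A₀, A₁⊗A₀ + A₀⊗A₁, A₂⊗A₀ + A₀⊗A₂, A₁⊗A₁, A₂⊗A₁ + A₁⊗A₂, A₂⊗A₂} span a fusion of the tensor square; that is, their ℝ-linear span is closed under matrix multiplication. (This is the generalized Hamming scheme H(2,𝒜), the symmetric 2-tensor fusion, partition 24|37|5|68|9.) -/
open Matrix Kronecker

/-- The symmetrized Kronecker product `X ⊗ Y + Y ⊗ X`, as a bilinear map. -/
noncomputable def symKronecker (m R : Type*) [CommSemiring R] :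
    Matrix m m R →ₗ[R] Matrix m m R →ₗ[R] Matrix (m × m) (m × m) R :=
  let f : Matrix m m R →ₗ[R] Matrix m m R →ₗ[R] Matrix (m × m) (m × m) R := kroneckerBilinear
  f + f.flip

section symKronecker

variable {m R : Type*} [CommSemiring R]

theorem symKronecker_apply (X Y : Matrix m m R) :
    symKronecker m R X Y = X ⊗ₖ Y + Y ⊗ₖ X := rfl

theorem symKronecker_comm (X Y : Matrix m m R) :
    symKronecker m R X Y = symKronecker m R Y X := by
  simp only [symKronecker_apply, add_comm]

theorem symKronecker_self (X : Matrix m m R) :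
    symKronecker m R X X = (2 : R) • (X ⊗ₖ X) := by
  rw [symKronecker_apply, two_smul]

theorem symKronecker_mul_symKronecker [Fintype m] (X Y Z W : Matrix m m R) :
    symKronecker m R X Y * symKronecker m R Z W =
      symKronecker m R (X * Z) (Y * W) + symKronecker m R (X * W) (Y * Z) := by
  simp only [symKronecker_apply, add_mul, mul_add, ← mul_kronecker_mul]
  abel

/-- The symmetric square of a multiplicatively closed space of matrices is
multiplicatively closed. -/
theorem mul_mem_map₂_symKronecker [Fintype m] {V : Submodule R (Matrix m m R)}
    (hV : ∀ X ∈ V, ∀ Y ∈ V, X * Y ∈ V) {P Q : Matrix (m × m) (m × m) R}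
    (hP : P ∈ Submodule.map₂ (symKronecker m R) V V)
    (hQ : Q ∈ Submodule.map₂ (symKronecker m R) V V) :
    P * Q ∈ Submodule.map₂ (symKronecker m R) V V := by
  rw [Submodule.map₂_eq_span_image2] at hP hQ
  induction hP, hQ using Submodule.span_induction₂ with
  | mem_mem P Q hP hQ =>
    obtain ⟨X, hX, Y, hY, rfl⟩ := hP
    obtain ⟨Z, hZ, W, hW, rfl⟩ := hQ
    rw [symKronecker_mul_symKronecker]
    exact add_mem
      (Submodule.apply_mem_map₂ _ (hV X hX Z hZ) (hV Y hY W hW))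
      (Submodule.apply_mem_map₂ _ (hV X hX W hW) (hV Y hY Z hZ))
  | zero_left Q _ => rw [zero_mul]; exact zero_mem _
  | zero_right P _ => rw [mul_zero]; exact zero_mem _
  | add_left P P' Q _ _ _ h h' => rw [add_mul]; exact add_mem h h'
  | add_right P Q Q' _ _ _ h h' => rw [mul_add]; exact add_mem h h'
  | smul_left r P Q _ _ h => rw [smul_mul_assoc]; exact Submodule.smul_mem _ _ h
  | smul_right r P Q _ _ h => rw [mul_smul_comm]; exact Submodule.smul_mem _ _ h

end symKronecker

theorem map₂_symKronecker_span_triple {m R : Type*} [Field R] [NeZero (2 : R)]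
    (A B C : Matrix m m R) :
    Submodule.map₂ (symKronecker m R) (Submodule.span R {A, B, C})
        (Submodule.span R {A, B, C}) =
      Submodule.span R {A ⊗ₖ A, B ⊗ₖ A + A ⊗ₖ B, C ⊗ₖ A + A ⊗ₖ C, B ⊗ₖ B,
        C ⊗ₖ B + B ⊗ₖ C, C ⊗ₖ C} := by
  rw [Submodule.map₂_span_span]
  apply Submodule.span_eq_span
  · rw [Set.image2_subset_iff]
    have self {S : Set (Matrix (m × m) (m × m) R)} {X : Matrix m m R} (h : X ⊗ₖ X ∈ S) :
        symKronecker m R X X ∈ Submodule.span R S := by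
      rw [symKronecker_self]
      exact Submodule.smul_mem _ _ (Submodule.subset_span h)
    have mixed {S : Set (Matrix (m × m) (m × m) R)} {X Y : Matrix m m R}
        (h : X ⊗ₖ Y + Y ⊗ₖ X ∈ S) :
        symKronecker m R X Y ∈ Submodule.span R S ∧
          symKronecker m R Y X ∈ Submodule.span R S := by
      rw [symKronecker_comm Y X]
      exact ⟨Submodule.subset_span h, Submodule.subset_span h⟩
    rintro X (rfl | rfl | rfl) Y (rfl | rfl | rfl)
    · exact self (by simp)
    · exact (mixed (by simp)).2
    · exact (mixed (by simp)).2
    · exact (mixed (by simp)).1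
    · exact self (by simp)
    · exact (mixed (by simp)).2
    · exact (mixed (by simp)).1
    · exact (mixed (by simp)).1
    · exact self (by simp)
  · have mixed {X Y : Matrix m m R} (hX : X ∈ ({A, B, C} : Set (Matrix m m R)))
        (hY : Y ∈ ({A, B, C} : Set (Matrix m m R))) :
        X ⊗ₖ Y + Y ⊗ₖ X ∈ Submodule.span R
          (Set.image2 (fun X Y => symKronecker m R X Y) {A, B, C} {A, B, C}) :=
      Submodule.subset_span ⟨X, hX, Y, hY, rfl⟩
    have self {X : Matrix m m R} (hX : X ∈ ({A, B, C} : Set (Matrix m m R))) :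
        X ⊗ₖ X ∈ Submodule.span R
          (Set.image2 (fun X Y => symKronecker m R X Y) {A, B, C} {A, B, C}) := by
      rw [← Submodule.smul_mem_iff _ (two_ne_zero (α := R)), two_smul]
      exact mixed hX hX
    rintro Z (rfl | rfl | rfl | rfl | rfl | rfl)
    · exact self (by simp)
    · exact mixed (by simp) (by simp)
    · exact mixed (by simp) (by simp)
    · exact self (by simp)
    · exact mixed (by simp) (by simp)
    · exact self (by simp)

/-- The Bose–Mesner algebra of a strongly regular graph is closed under multiplication. -/
theorem SimpleGraph.IsSRGWith.mul_mem_span {V R : Type*} [Fintype V] [DecidableEq V]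
    [CommRing R] {n k μ ν : ℕ} {G : SimpleGraph V} [DecidableRel G.Adj]
    (h : G.IsSRGWith n k μ ν) {X Y : Matrix V V R}
    (hX : X ∈ Submodule.span R {1, G.adjMatrix R, (of fun _ _ => 1) - 1 - G.adjMatrix R})
    (hY : Y ∈ Submodule.span R {1, G.adjMatrix R, (of fun _ _ => 1) - 1 - G.adjMatrix R}) :
    X * Y ∈ Submodule.span R {1, G.adjMatrix R, (of fun _ _ => 1) - 1 - G.adjMatrix R} := by
  set A := G.adjMatrix R with hA
  set J : Matrix V V R := of fun _ _ => 1 with hJ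
  set C := J - 1 - A with hC
  set W := Submodule.span R {1, A, C} with hW
  have h1 : (1 : Matrix V V R) ∈ W := Submodule.subset_span (by simp)
  have hAW : A ∈ W := Submodule.subset_span (by simp)
  have hCW : C ∈ W := Submodule.subset_span (by simp)
  have hJW : J ∈ W := by
    have : J = 1 + A + C := by rw [hC]; abel
    rw [this]
    exact add_mem (add_mem h1 hAW) hCW
  have hcompl : Gᶜ.adjMatrix R = C := by
    ext v w
    by_cases hvw : v = w
    · simp [hC, hJ, hA, adjMatrix_apply, hvw]
    · by_cases ha : G.Adj v w <;> simp [hC, hJ, hA, adjMatrix_apply, hvw, ha]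
  have hAA : A * A ∈ W := by
    rw [← sq, h.matrix_eq, hcompl]
    exact add_mem (add_mem (nsmul_mem h1 _) (nsmul_mem hAW _)) (nsmul_mem hCW _)
  have hAJ : A * J ∈ W := by
    have : A * J = k • J := by
      ext v w
      simp [hA, hJ, h.regular.degree_eq]
    rw [this]
    exact nsmul_mem hJW _
  have hJA : J * A ∈ W := by
    have : J * A = k • J := by
      ext v w
      simp [hA, hJ, h.regular.degree_eq]
    rw [this]
    exact nsmul_mem hJW _
  have hJJ : J * J ∈ W := by
    have : J * J = Fintype.card V • J := by
      ext v w
      simp [hJ, mul_apply]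
    rw [this]
    exact nsmul_mem hJW _
  have hAC : A * C ∈ W := by
    rw [hC, mul_sub, mul_sub, mul_one]
    exact sub_mem (sub_mem hAJ hAW) hAA
  have hCA : C * A ∈ W := by
    rw [hC, sub_mul, sub_mul, one_mul]
    exact sub_mem (sub_mem hJA hAW) hAA
  have hJC : J * C ∈ W := by
    rw [hC, mul_sub, mul_sub, mul_one]
    exact sub_mem (sub_mem hJJ hJW) hJA
  have hCC : C * C ∈ W := by
    nth_rewrite 1 [hC]
    rw [sub_mul, sub_mul, one_mul]
    exact sub_mem (sub_mem hJC hCW) hAC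
  have key : W * W ≤ W := by
    nth_rewrite 1 2 [hW]
    rw [Submodule.span_mul_span, Submodule.span_le]
    rintro _ ⟨X, rfl | rfl | rfl, Y, rfl | rfl | rfl, rfl⟩ <;> simpa
  exact key (Submodule.mul_mem_mul hX hY)

theorem sym2_fusion {n k μ ν : ℕ} (Γ : SimpleGraph (Fin n)) [DecidableRel Γ.Adj]
    (h : Γ.IsSRGWith n k μ ν) :
    let A₀ : Matrix (Fin n) (Fin n) ℝ := 1
    let A₁ : Matrix (Fin n) (Fin n) ℝ := Γ.adjMatrix ℝ
    let J : Matrix (Fin n) (Fin n) ℝ := Matrix.of fun _ _ => 1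
    let A₂ : Matrix (Fin n) (Fin n) ℝ := J - 1 - A₁
    let S : Set (Matrix (Fin n × Fin n) (Fin n × Fin n) ℝ) :=
      {A₀ ⊗ₖ A₀, A₁ ⊗ₖ A₀ + A₀ ⊗ₖ A₁, A₂ ⊗ₖ A₀ + A₀ ⊗ₖ A₂, A₁ ⊗ₖ A₁,
        A₂ ⊗ₖ A₁ + A₁ ⊗ₖ A₂, A₂ ⊗ₖ A₂}
    ∀ X ∈ Submodule.span ℝ S, ∀ Y ∈ Submodule.span ℝ S, X * Y ∈ Submodule.span ℝ S := by
  intro A₀ A₁ J A₂ S X hX Y hY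
  rw [← map₂_symKronecker_span_triple] at hX hY ⊢
  exact mul_mem_map₂_symKronecker (fun _ hX _ hY => h.mul_mem_span hX hY) hX hY
end

section
/- Let Γ be strongly regular with parameters (n,k,μ,ν) with ν = 0 (so Γ is a disjoint union of complete graphs on k+1 vertices), and assume 1 ≤ k and k + 2 ≤ n. Then the three matrices {A₀⊗A₀, (A₀+A₁)⊗(A₀+A₁), J⊗J} span a fusion of the tensor square; that is, their ℝ-linear span is closed under matrix multiplication. (This is the rank-3 special case fusion with partition 245|36789 of Theorem 4.2.) -/
open Matrix Kronecker

/-- A linear span is closed under multiplication as soon as it contains all products of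
generators. -/
theorem Submodule.mul_mem_span_of_forall_mul_mem {R A : Type*} [CommSemiring R] [Semiring A]
    [Algebra R A] {S : Set A} (hS : ∀ x ∈ S, ∀ y ∈ S, x * y ∈ span R S) {x y : A}
    (hx : x ∈ span R S) (hy : y ∈ span R S) : x * y ∈ span R S := by
  have hle : span R S * span R S ≤ span R S := by
    rw [span_mul_span, span_le]
    rintro _ ⟨a, ha, b, hb, rfl⟩
    exact hS a ha b hb
  exact hle (mul_mem_mul hx hy)

namespace SimpleGraph

variable {V R : Type*} [Fintype V] {G : SimpleGraph V} [DecidableRel G.Adj] {n k l : ℕ}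

/-- In a nonempty disjoint union of complete graphs, an edge has `k - 1` common neighbors. -/
theorem IsSRGWith.eq_add_one_of_nonadj_zero [Nonempty V] (h : G.IsSRGWith n k l 0) (hk : 1 ≤ k) :
    k = l + 1 := by
  have hn : 0 < n := h.card ▸ Fintype.card_pos
  have hp := h.param_eq G hn
  obtain ⟨v⟩ := ‹Nonempty V›
  obtain ⟨w, hw⟩ : ∃ w, G.Adj v w := by
    rw [← G.degree_pos_iff_exists_adj, h.regular.degree_eq]
    exact hk
  have hlt := hw.card_commonNeighbors_lt_degree
  rw [h.of_adj v w hw, h.regular.degree_eq] at hlt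
  rw [Nat.mul_zero, Nat.mul_eq_zero] at hp
  omega

variable [DecidableEq V]

theorem IsRegularOfDegree.one_add_adjMatrix_mul_allOnes [NonAssocSemiring R]
    (h : G.IsRegularOfDegree k) :
    (1 + G.adjMatrix R) * (Matrix.of fun _ _ => 1 : Matrix V V R) =
      ((k : R) + 1) • (Matrix.of fun _ _ => 1 : Matrix V V R) := by
  ext i j
  simp [add_mul, h.degree_eq, add_comm]

theorem IsRegularOfDegree.allOnes_mul_one_add_adjMatrix [NonAssocSemiring R]
    (h : G.IsRegularOfDegree k) :
    (Matrix.of fun _ _ => 1 : Matrix V V R) * (1 + G.adjMatrix R) =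
      ((k : R) + 1) • (Matrix.of fun _ _ => 1 : Matrix V V R) := by
  ext i j
  simp [mul_add, h.degree_eq, add_comm]

theorem IsSRGWith.one_add_adjMatrix_mul_self [Nonempty V] [CommRing R]
    (h : G.IsSRGWith n k l 0) (hk : 1 ≤ k) :
    (1 + G.adjMatrix R) * (1 + G.adjMatrix R) = ((k : R) + 1) • (1 + G.adjMatrix R) := by
  have hA := h.matrix_eq (α := R)
  obtain rfl := h.eq_add_one_of_nonadj_zero hk
  rw [add_mul, mul_add, mul_add, ← sq (G.adjMatrix R), hA]
  simp only [← Nat.cast_smul_eq_nsmul R]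
  push_cast
  simp only [one_mul, mul_one]
  module

end SimpleGraph

theorem imprimitive_rank3_fusion {n k μ ν : ℕ} (Γ : SimpleGraph (Fin n)) [DecidableRel Γ.Adj]
    (h : Γ.IsSRGWith n k μ ν) (hν : ν = 0) (hk : 1 ≤ k) (hn : k + 2 ≤ n) :
    let A₀ : Matrix (Fin n) (Fin n) ℝ := 1
    let A₁ : Matrix (Fin n) (Fin n) ℝ := Γ.adjMatrix ℝ
    let J : Matrix (Fin n) (Fin n) ℝ := Matrix.of fun _ _ => 1
    let A₂ : Matrix (Fin n) (Fin n) ℝ := J - 1 - A₁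
    let S : Set (Matrix (Fin n × Fin n) (Fin n × Fin n) ℝ) :=
      {A₀ ⊗ₖ A₀, (A₀ + A₁) ⊗ₖ (A₀ + A₁), J ⊗ₖ J}
    ∀ X ∈ Submodule.span ℝ S, ∀ Y ∈ Submodule.span ℝ S, X * Y ∈ Submodule.span ℝ S := by
  intro A₀ A₁ J A₂ S X hX Y hY
  subst hν
  have : Nonempty (Fin n) := ⟨⟨0, by omega⟩⟩
  have hBB : (A₀ + A₁) * (A₀ + A₁) = ((k : ℝ) + 1) • (A₀ + A₁) := h.one_add_adjMatrix_mul_self hk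
  have hBJ : (A₀ + A₁) * J = ((k : ℝ) + 1) • J := h.regular.one_add_adjMatrix_mul_allOnes
  have hJB : J * (A₀ + A₁) = ((k : ℝ) + 1) • J := h.regular.allOnes_mul_one_add_adjMatrix
  have hJJ : J * J = (n : ℝ) • J := by
    ext i j
    simp [J, Matrix.mul_apply]
  have hI : A₀ ⊗ₖ A₀ = 1 := one_kronecker_one
  have hB : (A₀ + A₁) ⊗ₖ (A₀ + A₁) ∈ Submodule.span ℝ S := Submodule.subset_span (by simp [S])
  have hJ : J ⊗ₖ J ∈ Submodule.span ℝ S := Submodule.subset_span (by simp [S])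
  refine Submodule.mul_mem_span_of_forall_mul_mem ?_ hX hY
  intro x hx y hy
  have hx' := Submodule.subset_span (R := ℝ) hx
  have hy' := Submodule.subset_span (R := ℝ) hy
  rcases hx with rfl | rfl | rfl
  · rwa [hI, one_mul]
  all_goals
    rcases hy with rfl | rfl | rfl
    · rwa [hI, mul_one]
    all_goals
      rw [← mul_kronecker_mul]
      simp only [hBB, hBJ, hJB, hJJ, smul_kronecker, kronecker_smul]
      exact Submodule.smul_mem _ _ (Submodule.smul_mem _ _ ‹_›)
end

section
/- Let Γ be strongly regular with parameters (n,k,μ,ν) with 1 ≤ k and k + 2 ≤ n. Then the ℝ-linear span of the three matrices {A₀⊗A₀, A₁⊗A₀, J⊗J} is closed under matrix multiplication if and only if ν = 0 (i.e., Γ is a disjoint union of complete graphs). (This is the special case fusion with partition 2|3456789 of Theorem 3.1(3), which exists exactly in the imprimitive case k = r, s = -1.) -/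
open Matrix Kronecker

namespace SimpleGraph

/-- A regular graph whose degree is less than `n - 1` has two distinct nonadjacent vertices. -/
theorem IsRegularOfDegree.exists_ne_not_adj {V : Type*} [Fintype V] {G : SimpleGraph V}
    [DecidableRel G.Adj] {k : ℕ} (h : G.IsRegularOfDegree k) (hk : k + 2 ≤ Fintype.card V) :
    ∃ u v, u ≠ v ∧ ¬G.Adj u v := by
  classical
  have : Nonempty V := Fintype.card_pos_iff.mp (by omega)
  obtain ⟨u⟩ := this
  by_contra! hadj
  have huniv : Finset.univ = insert u (G.neighborFinset u) := by
    ext v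
    by_cases huv : u = v
    · simp [huv]
    · simp [hadj u v huv]
  have hcard := Finset.card_insert_le u (G.neighborFinset u)
  rw [← huniv, Finset.card_univ, G.card_neighborFinset_eq_degree, h.degree_eq] at hcard
  omega

variable {V R : Type*} [Fintype V] [Semiring R] {G : SimpleGraph V} [DecidableRel G.Adj] {k : ℕ}

theorem IsRegularOfDegree.adjMatrix_mul_ones (h : G.IsRegularOfDegree k) :
    G.adjMatrix R * (Matrix.of fun _ _ => 1) = (k : R) • Matrix.of fun _ _ => 1 := by
  ext i j
  simp [adjMatrix_mul_apply, h.degree_eq]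

theorem IsRegularOfDegree.ones_mul_adjMatrix (h : G.IsRegularOfDegree k) :
    (Matrix.of fun _ _ => 1) * G.adjMatrix R = (k : R) • Matrix.of fun _ _ => 1 := by
  ext i j
  simp [mul_adjMatrix_apply, h.degree_eq]

end SimpleGraph

theorem Matrix.ones_mul_ones {m R : Type*} [Fintype m] [Semiring R] :
    (Matrix.of fun _ _ => 1 : Matrix m m R) * (Matrix.of fun _ _ => 1) =
      (Fintype.card m : R) • Matrix.of fun _ _ => 1 := by
  ext i j
  simp [Matrix.mul_apply]

theorem special_fusion_iff_imprimitive {n k μ ν : ℕ} (Γ : SimpleGraph (Fin n))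
    [DecidableRel Γ.Adj] (h : Γ.IsSRGWith n k μ ν) (hk : 1 ≤ k) (hn : k + 2 ≤ n) :
    let A₀ : Matrix (Fin n) (Fin n) ℝ := 1
    let A₁ : Matrix (Fin n) (Fin n) ℝ := Γ.adjMatrix ℝ
    let J : Matrix (Fin n) (Fin n) ℝ := Matrix.of fun _ _ => 1
    let S : Set (Matrix (Fin n × Fin n) (Fin n × Fin n) ℝ) :=
      {A₀ ⊗ₖ A₀, A₁ ⊗ₖ A₀, J ⊗ₖ J}
    (∀ X ∈ Submodule.span ℝ S, ∀ Y ∈ Submodule.span ℝ S,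
      X * Y ∈ Submodule.span ℝ S) ↔ ν = 0 := by
  intro A₀ A₁ J S
  have hA₁ : A₁ * A₁ = (k : ℝ) • A₀ + (μ : ℝ) • A₁ + (ν : ℝ) • Γᶜ.adjMatrix ℝ := by
    simpa only [sq, Nat.cast_smul_eq_nsmul] using h.matrix_eq (α := ℝ)
  constructor
  · intro hmul
    have hmem : A₁ ⊗ₖ A₀ ∈ Submodule.span ℝ S := Submodule.subset_span (by simp [S])
    have hsq := hmul _ hmem _ hmem
    rw [← mul_kronecker_mul, hA₁, Submodule.mem_span_triple] at hsq
    obtain ⟨a, b, c, habc⟩ := hsq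
    obtain ⟨u, v, huv, hadj⟩ := h.regular.exists_ne_not_adj (by simpa using hn)
    have hsame := congr_fun₂ habc (u, u) (v, u)
    have hdiff := congr_fun₂ habc (u, u) (v, v)
    simp [A₀, A₁, J, huv, hadj] at hsame hdiff
    exact_mod_cast hsame.symm.trans hdiff
  · rintro rfl
    have h₀ : A₀ ⊗ₖ A₀ = 1 := one_kronecker_one
    have hone : (1 : Matrix (Fin n × Fin n) (Fin n × Fin n) ℝ) ∈ Submodule.span ℝ S :=
      Submodule.subset_span (by simp [S, h₀])
    have hA : A₁ ⊗ₖ A₀ ∈ Submodule.span ℝ S := Submodule.subset_span (by simp [S])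
    have hJ : J ⊗ₖ J ∈ Submodule.span ℝ S := Submodule.subset_span (by simp [S])
    have hAA : A₁ ⊗ₖ A₀ * A₁ ⊗ₖ A₀ = (k : ℝ) • 1 + (μ : ℝ) • A₁ ⊗ₖ A₀ := by
      rw [← mul_kronecker_mul, hA₁, ← h₀]
      simp [A₀, add_kronecker, smul_kronecker]
    have hAJ : A₁ ⊗ₖ A₀ * J ⊗ₖ J = (k : ℝ) • J ⊗ₖ J := by
      rw [← mul_kronecker_mul, h.regular.adjMatrix_mul_ones, smul_kronecker, one_mul]
    have hJA : J ⊗ₖ J * A₁ ⊗ₖ A₀ = (k : ℝ) • J ⊗ₖ J := by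
      rw [← mul_kronecker_mul, h.regular.ones_mul_adjMatrix, smul_kronecker, mul_one]
    have hJJ : J ⊗ₖ J * J ⊗ₖ J = (n : ℝ) • (n : ℝ) • J ⊗ₖ J := by
      rw [← mul_kronecker_mul, Matrix.ones_mul_ones, smul_kronecker, kronecker_smul,
        Fintype.card_fin]
    rw [← Submodule.mul_le, Submodule.span_mul_span, Submodule.span_le]
    rintro _ ⟨X, hX, Y, hY, rfl⟩
    simp only [S, h₀, Set.mem_insert_iff, Set.mem_singleton_iff] at hX hY
    rcases hX with rfl | rfl | rfl <;> rcases hY with rfl | rfl | rfl <;>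
      simp only [one_mul, mul_one, hAA, hAJ, hJA, hJJ, SetLike.mem_coe]
    all_goals first
      | assumption
      | exact Submodule.add_mem _ (Submodule.smul_mem _ _ hone) (Submodule.smul_mem _ _ hA)
      | exact Submodule.smul_mem _ _ hJ
      | exact Submodule.smul_mem _ _ (Submodule.smul_mem _ _ hJ)
end

section
/- Let Γ be strongly regular with parameters (n,k,μ,ν) with 1 ≤ k and k + 2 ≤ n. Then the ℝ-linear span of the three matrices {A₀⊗A₀, (J - A₀)⊗A₀ + J⊗A₁, J⊗A₂} is closed under matrix multiplication if and only if ν = 0 (i.e., Γ is a disjoint union of complete graphs). (This is the special case fusion with partition 23456|789 of Theorem 3.1(3), which exists exactly in the imprimitive case k = r, s = -1.) -/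
open Matrix Kronecker

namespace SimpleGraph.IsSRGWith

variable {V : Type*} [Fintype V] {G : SimpleGraph V} [DecidableRel G.Adj]
  {n k μ ν : ℕ}

/-- In a strongly regular graph of positive degree, two adjacent vertices have fewer than `k`
common neighbors. -/
theorem lt_degree [Nonempty V] (h : G.IsSRGWith n k μ ν) (hk : 1 ≤ k) : μ < k := by
  obtain ⟨v⟩ := ‹Nonempty V›
  obtain ⟨w, hw⟩ := (G.degree_pos_iff_exists_adj v).1 (by rw [h.regular.degree_eq]; exact hk)
  rw [← h.of_adj v w hw, ← h.regular.degree_eq v]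
  exact hw.card_commonNeighbors_lt_degree

/-- A strongly regular graph which is neither empty nor complete satisfies `ν = 0` if and only if
any two adjacent vertices have `k - 1` common neighbors. -/
theorem eq_zero_iff [Nonempty V] (h : G.IsSRGWith n k μ ν) (hk : 1 ≤ k) (hn : k + 2 ≤ n) :
    ν = 0 ↔ k = μ + 1 := by
  have hμ := h.lt_degree hk
  have hp := h.param_eq G (by lia)
  constructor
  · rintro rfl
    rcases Nat.mul_eq_zero.1 (hp.trans (mul_zero _)) with h0 | h0 <;> lia
  · intro hkμ
    have h0 : k - μ - 1 = 0 := by lia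
    rw [h0, mul_zero] at hp
    rcases Nat.mul_eq_zero.1 hp.symm with h0 | h0 <;> lia

end SimpleGraph.IsSRGWith

/-- If `P` and `Q` satisfy the given multiplication table, the span of `1`, `P - 1` and `Q - P`
is closed under multiplication. -/
theorem mul_mem_span_of_mul_table {R : Type*} [Ring R] [Algebra ℝ R] {P Q : R} {d e : ℝ}
    (hPP : P * P = d • P) (hPQ : P * Q = d • Q) (hQP : Q * P = d • Q) (hQQ : Q * Q = e • Q)
    {X Y : R} (hX : X ∈ Submodule.span ℝ {1, P - 1, Q - P})
    (hY : Y ∈ Submodule.span ℝ {1, P - 1, Q - P}) :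
    X * Y ∈ Submodule.span ℝ {1, P - 1, Q - P} := by
  rw [Submodule.mem_span_triple] at hX hY ⊢
  obtain ⟨a, b, c, rfl⟩ := hX
  obtain ⟨a', b', c', rfl⟩ := hY
  set β := (a - b) * (b' - c') + (b - c) * (a' - b') + (b - c) * (b' - c') * d with hβ
  set γ := (a - b) * c' + c * (a' - b') + ((b - c) * c' + c * (b' - c')) * d + c * c' * e with hγ
  refine ⟨(a - b) * (a' - b') + β + γ, β + γ, γ, ?_⟩
  simp only [add_mul, mul_add, sub_mul, mul_sub, smul_mul_assoc, mul_smul_comm, one_mul, mul_one,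
    hPP, hPQ, hQP, hQQ]
  rw [hβ, hγ]
  module

theorem special_fusion_iff_imprimitive' {n k μ ν : ℕ} (Γ : SimpleGraph (Fin n))
    [DecidableRel Γ.Adj] (h : Γ.IsSRGWith n k μ ν) (hk : 1 ≤ k) (hn : k + 2 ≤ n) :
    let A₀ : Matrix (Fin n) (Fin n) ℝ := 1
    let A₁ : Matrix (Fin n) (Fin n) ℝ := Γ.adjMatrix ℝ
    let J : Matrix (Fin n) (Fin n) ℝ := Matrix.of fun _ _ => 1
    let A₂ : Matrix (Fin n) (Fin n) ℝ := J - 1 - A₁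
    let S : Set (Matrix (Fin n × Fin n) (Fin n × Fin n) ℝ) :=
      {A₀ ⊗ₖ A₀, (J - A₀) ⊗ₖ A₀ + J ⊗ₖ A₁, J ⊗ₖ A₂}
    (∀ X ∈ Submodule.span ℝ S, ∀ Y ∈ Submodule.span ℝ S,
      X * Y ∈ Submodule.span ℝ S) ↔ ν = 0 := by
  intro A₀ A₁ J A₂ S
  have : Nontrivial (Fin n) := Fin.nontrivial_iff_two_le.2 (by lia)
  obtain ⟨i, j, hij⟩ := exists_pair_ne (Fin n)
  obtain ⟨w, hw⟩ := (Γ.degree_pos_iff_exists_adj i).1 (by rw [h.regular.degree_eq]; exact hk)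
  have hJJ : J * J = (n : ℝ) • J := by
    ext x y
    simp [J, Matrix.mul_apply]
  have hAJ : A₁ * J = (k : ℝ) • J := by
    ext x y
    simp [J, A₁, h.regular.degree_eq x]
  have hJA : J * A₁ = (k : ℝ) • J := by
    ext x y
    simp [J, A₁, h.regular.degree_eq y]
  have hAA : A₁ * A₁ = (k : ℝ) • 1 + (μ : ℝ) • A₁ + (ν : ℝ) • A₂ := by
    have hC : Γᶜ.adjMatrix ℝ = A₂ := by
      ext x y
      by_cases hxy : x = y <;> by_cases ha : Γ.Adj x y <;>
        simp_all [A₂, J, A₁]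
    have hm := h.matrix_eq (α := ℝ)
    rw [hC] at hm
    rw [← sq, hm]
    simp only [Nat.cast_smul_eq_nsmul, A₁]
  have hS : S = {1, J ⊗ₖ (1 + A₁) - 1, J ⊗ₖ J - J ⊗ₖ (1 + A₁)} := by
    have h0 : A₀ ⊗ₖ A₀ = 1 := Matrix.one_kronecker_one
    have h1 : (J - A₀) ⊗ₖ A₀ + J ⊗ₖ A₁ = J ⊗ₖ (1 + A₁) - 1 := by
      have h2 : (J - A₀) ⊗ₖ A₀ + A₀ ⊗ₖ A₀ = J ⊗ₖ 1 := by
        rw [← Matrix.add_kronecker, sub_add_cancel]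
      rw [Matrix.kronecker_add, ← h2, h0]
      abel
    have h2 : J ⊗ₖ A₂ = J ⊗ₖ J - J ⊗ₖ (1 + A₁) := by
      rw [eq_sub_iff_add_eq, ← Matrix.kronecker_add]
      congr 1
      simp only [A₂]
      abel
    simp only [S, h0, h1, h2]
  rw [h.eq_zero_iff hk hn]
  constructor
  · intro hmul
    have hP : J ⊗ₖ (1 + A₁) ∈ Submodule.span ℝ S := by
      rw [hS, Submodule.mem_span_triple]
      exact ⟨1, 1, 0, by module⟩
    have hPP := hmul _ hP _ hP
    rw [← Matrix.mul_kronecker_mul, hJJ, add_mul, mul_add, one_mul, mul_add, one_mul, mul_one, hAA,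
      Submodule.mem_span_triple] at hPP
    obtain ⟨a, b, c, habc⟩ := hPP
    have hdiag := congrFun (congrFun habc (i, i)) (j, i)
    have hadj := congrFun (congrFun habc (i, i)) (j, w)
    have hn0 : (n : ℝ) ≠ 0 := by
      norm_cast
      lia
    simp [A₀, A₁, A₂, J, hij] at hdiag
    simp [A₀, A₁, A₂, J, hij, hw, hw.ne] at hadj
    have hkμ : (n : ℝ) * k = n * (μ + 1) := by linarith
    exact_mod_cast mul_left_cancel₀ hn0 hkμ
  · intro hkμ X hX Y hY
    have hν := (h.eq_zero_iff hk hn).2 hkμ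
    have hCC : (1 + A₁) * (1 + A₁) = ((k : ℝ) + 1) • (1 + A₁) := by
      rw [add_mul, mul_add, one_mul, mul_add, one_mul, mul_one, hAA, hν, hkμ]
      push_cast
      module
    have hCJ : (1 + A₁) * J = ((k : ℝ) + 1) • J := by
      rw [add_mul, one_mul, hAJ]
      module
    have hJC : J * (1 + A₁) = ((k : ℝ) + 1) • J := by
      rw [mul_add, mul_one, hJA]
      module
    rw [hS] at hX hY ⊢
    refine mul_mem_span_of_mul_table (d := (k + 1) * n) (e := n * n) ?_ ?_ ?_ ?_ hX hY <;>
      simp only [← Matrix.mul_kronecker_mul, hJJ, hCC, hCJ, hJC, Matrix.smul_kronecker,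
        Matrix.kronecker_smul, smul_smul]
end

section
/- Let Γ be strongly regular with parameters (n,k,μ,ν) satisfying ν = k and μ + n = 2k (i.e., Γ is a complete multipartite graph, the imprimitive case r = 0, ℓ = -1-s), with 1 ≤ k and k + 2 ≤ n. Then the four matrices {A₀⊗A₀, A₁⊗A₀ + J⊗A₂, A₂⊗A₀, J⊗A₁} span a fusion of the tensor square; that is, their ℝ-linear span is closed under matrix multiplication. (This is the special case fusion with partition 2789|3|456 of Theorem 3.1(3).) -/
open Matrix Kronecker

/-- The span of a set of elements of an algebra is closed under multiplication as soon as
it contains the pairwise products of the set. -/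
theorem Submodule.mul_mem_span_of_subset {R A : Type*} [CommSemiring R] [Semiring A] [Algebra R A]
    {S : Set A} (hS : ∀ x ∈ S, ∀ y ∈ S, x * y ∈ Submodule.span R S) {x y : A}
    (hx : x ∈ Submodule.span R S) (hy : y ∈ Submodule.span R S) :
    x * y ∈ Submodule.span R S := by
  have hle : Submodule.span R S * Submodule.span R S ≤ Submodule.span R S := by
    rw [Submodule.span_mul_span, Submodule.span_le]
    exact Set.mul_subset_iff.2 hS
  exact hle (Submodule.mul_mem_mul hx hy)

/-- Linear combinations of four elements lie in their span. -/
theorem Submodule.combination_mem_span_four {R M : Type*} [Semiring R] [AddCommMonoid M]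
    [Module R M] (w x y z : M) (a b c d : R) :
    a • w + b • x + c • y + d • z ∈ Submodule.span R ({w, x, y, z} : Set M) := by
  refine add_mem (add_mem (add_mem ?_ ?_) ?_) ?_ <;>
    exact Submodule.smul_mem _ _ (Submodule.subset_span (by simp))

/-- The fusion attached to matrices `A`, `J` satisfying the relations of the adjacency matrix of
a complete multipartite graph of degree `k` on `n` vertices and of the all-ones matrix. -/
theorem Matrix.mul_mem_span_kronecker_fusion {R V : Type*} [CommRing R] [Fintype V] [DecidableEq V]
    {A J : Matrix V V R} {n k : R} (hJJ : J * J = n • J) (hAJ : A * J = k • J)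
    (hJA : J * A = k • J) (hAA : A * A = k • J - (n - k) • A)
    {X Y : Matrix (V × V) (V × V) R}
    (hX : X ∈ Submodule.span R ({(1 : Matrix V V R) ⊗ₖ (1 : Matrix V V R),
      A ⊗ₖ (1 : Matrix V V R) + J ⊗ₖ (J - 1 - A), (J - 1 - A) ⊗ₖ (1 : Matrix V V R),
      J ⊗ₖ A} : Set (Matrix (V × V) (V × V) R)))
    (hY : Y ∈ Submodule.span R ({(1 : Matrix V V R) ⊗ₖ (1 : Matrix V V R),
      A ⊗ₖ (1 : Matrix V V R) + J ⊗ₖ (J - 1 - A), (J - 1 - A) ⊗ₖ (1 : Matrix V V R),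
      J ⊗ₖ A} : Set (Matrix (V × V) (V × V) R))) :
    X * Y ∈ Submodule.span R ({(1 : Matrix V V R) ⊗ₖ (1 : Matrix V V R),
      A ⊗ₖ (1 : Matrix V V R) + J ⊗ₖ (J - 1 - A), (J - 1 - A) ⊗ₖ (1 : Matrix V V R),
      J ⊗ₖ A} : Set (Matrix (V × V) (V × V) R)) := by
  have sub_kron (P Q T : Matrix V V R) : (P - Q) ⊗ₖ T = P ⊗ₖ T - Q ⊗ₖ T := by
    ext; simp [sub_mul]
  have kron_sub (P Q T : Matrix V V R) : T ⊗ₖ (P - Q) = T ⊗ₖ P - T ⊗ₖ Q := by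
    ext; simp [mul_sub]
  refine Submodule.mul_mem_span_of_subset ?_ hX hY
  have key (P : Matrix (V × V) (V × V) R) (a b c d : R)
      (hP : P = a • ((1 : Matrix V V R) ⊗ₖ (1 : Matrix V V R)) +
        b • (A ⊗ₖ (1 : Matrix V V R) + J ⊗ₖ (J - 1 - A)) +
        c • ((J - 1 - A) ⊗ₖ (1 : Matrix V V R)) + d • (J ⊗ₖ A)) :
      P ∈ Submodule.span R ({(1 : Matrix V V R) ⊗ₖ (1 : Matrix V V R),
        A ⊗ₖ (1 : Matrix V V R) + J ⊗ₖ (J - 1 - A), (J - 1 - A) ⊗ₖ (1 : Matrix V V R),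
        J ⊗ₖ A} : Set (Matrix (V × V) (V × V) R)) :=
    hP ▸ Submodule.combination_mem_span_four _ _ _ _ a b c d
  have one_kron_mul (P : Matrix (V × V) (V × V) R) :
      (1 : Matrix V V R) ⊗ₖ (1 : Matrix V V R) * P = P := by
    rw [one_kronecker_one, one_mul]
  have mul_one_kron (P : Matrix (V × V) (V × V) R) :
      P * (1 : Matrix V V R) ⊗ₖ (1 : Matrix V V R) = P := by
    rw [one_kronecker_one, mul_one]
  rintro X hX Y hY
  rcases id hX with rfl | rfl | rfl | rfl
  · rw [one_kron_mul]
    exact Submodule.subset_span hY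
  all_goals
    rcases id hY with rfl | rfl | rfl | rfl
    · rw [mul_one_kron]
      exact Submodule.subset_span hX
  map_tacs [
    refine key _ (k + n * (n - k - 1)) (k + n * (n - k - 1) - (n - k))
      (k + n * (n - k - 1)) 0 ?_;
    refine key _ 0 (n - k - 1) 0 0 ?_;
    refine key _ 0 0 0 (k + n * (n - k - 1)) ?_;
    refine key _ 0 (n - k - 1) 0 0 ?_;
    refine key _ (n - k - 1) 0 (n - k - 2) 0 ?_;
    refine key _ 0 0 0 (n - k - 1) ?_;
    refine key _ 0 0 0 (k + n * (n - k - 1)) ?_;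
    refine key _ 0 0 0 (n - k - 1) ?_;
    refine key _ (n * k) (n * k) (n * k) (n * k - n * (n - k)) ?_]
  all_goals
    simp only [mul_add, add_mul, ← mul_kronecker_mul, mul_sub, sub_mul, mul_one, one_mul,
      sub_kron, kron_sub, hJJ, hAJ, hJA, hAA, smul_kronecker, kronecker_smul]
    module

theorem multipartite_special_fusion {n k μ ν : ℕ} (Γ : SimpleGraph (Fin n))
    [DecidableRel Γ.Adj] (h : Γ.IsSRGWith n k μ ν)
    (hν : ν = k) (hμ : μ + n = 2 * k) (hk : 1 ≤ k) (hn : k + 2 ≤ n) :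
    let A₀ : Matrix (Fin n) (Fin n) ℝ := 1
    let A₁ : Matrix (Fin n) (Fin n) ℝ := Γ.adjMatrix ℝ
    let J : Matrix (Fin n) (Fin n) ℝ := Matrix.of fun _ _ => 1
    let A₂ : Matrix (Fin n) (Fin n) ℝ := J - 1 - A₁
    let S : Set (Matrix (Fin n × Fin n) (Fin n × Fin n) ℝ) :=
      {A₀ ⊗ₖ A₀, A₁ ⊗ₖ A₀ + J ⊗ₖ A₂, A₂ ⊗ₖ A₀, J ⊗ₖ A₁}
    ∀ X ∈ Submodule.span ℝ S, ∀ Y ∈ Submodule.span ℝ S, X * Y ∈ Submodule.span ℝ S := by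
  intro A₀ A₁ J A₂ S X hX Y hY
  have hJJ : J * J = (n : ℝ) • J := by
    ext i j
    simp [J, Matrix.mul_apply]
  have hAJ : A₁ * J = (k : ℝ) • J := by
    ext i j
    simp [A₁, J, SimpleGraph.adjMatrix_mul_apply, h.regular.degree_eq i]
  have hJA : J * A₁ = (k : ℝ) • J := by
    ext i j
    simp [A₁, J, SimpleGraph.mul_adjMatrix_apply, h.regular.degree_eq j]
  have hcompl : Γᶜ.adjMatrix ℝ = J - 1 - A₁ := by
    ext i j
    obtain rfl | hij := eq_or_ne i j
    · simp [J, A₁]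
    · by_cases hadj : Γ.Adj i j <;> simp [J, A₁, SimpleGraph.adjMatrix_apply, hij, hadj]
  have hμ' : (μ : ℝ) = 2 * k - n := by
    rw [eq_sub_iff_add_eq]
    exact_mod_cast hμ
  have hAA : A₁ * A₁ = (k : ℝ) • J - ((n : ℝ) - k) • A₁ := by
    rw [← sq, h.matrix_eq, hcompl, hν, ← Nat.cast_smul_eq_nsmul ℝ k,
      ← Nat.cast_smul_eq_nsmul ℝ μ, ← Nat.cast_smul_eq_nsmul ℝ k, hμ']
    module
  exact Matrix.mul_mem_span_kronecker_fusion hJJ hAJ hJA hAA hX hY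
end

section
/- Let Γ be a conference graph: strongly regular with parameters (4ν+1, 2ν, ν-1, ν) for some ν ≥ 1. Then the five matrices {A₀⊗A₀, (J - A₀)⊗A₀, A₀⊗(J - A₀), A₁⊗A₁ + A₂⊗A₂, A₂⊗A₁ + A₁⊗A₂} span a fusion of the tensor square; that is, their ℝ-linear span is closed under matrix multiplication. (This is the rank-5 special case fusion with partition 23|47|59|68 of Theorem 4.3.) -/
open Matrix Kronecker

/-- If the span of `1, C, D` has the multiplication table of the Bose–Mesner algebra of a conference
graph, with `C = J - 1` and `D` the Seidel matrix, then the listed Kronecker products span a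
subspace closed under multiplication. -/
theorem span_kronecker_mul_le {n : Type*} [Fintype n] [DecidableEq n] {C D : Matrix n n ℝ}
    {a b : ℝ} (hCC : C * C = a • 1 + b • C) (hCD : C * D = -D) (hDC : D * C = -D)
    (hDD : D * D = a • 1 - C) :
    Submodule.span ℝ {1 ⊗ₖ 1, C ⊗ₖ 1, 1 ⊗ₖ C, C ⊗ₖ C, D ⊗ₖ D} *
        Submodule.span ℝ {1 ⊗ₖ 1, C ⊗ₖ 1, 1 ⊗ₖ C, C ⊗ₖ C, D ⊗ₖ D} ≤
      Submodule.span ℝ {(1 : Matrix n n ℝ) ⊗ₖ (1 : Matrix n n ℝ), C ⊗ₖ 1, 1 ⊗ₖ C, C ⊗ₖ C,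
        D ⊗ₖ D} := by
  rw [Submodule.span_mul_span, Submodule.span_le]
  set W := Submodule.span ℝ {(1 : Matrix n n ℝ) ⊗ₖ (1 : Matrix n n ℝ), C ⊗ₖ 1, 1 ⊗ₖ C, C ⊗ₖ C,
    D ⊗ₖ D}
  have h₁₁ : (1 : Matrix n n ℝ) ⊗ₖ (1 : Matrix n n ℝ) ∈ W := Submodule.subset_span (by simp)
  have hC₁ : C ⊗ₖ (1 : Matrix n n ℝ) ∈ W := Submodule.subset_span (by simp)
  have h₁C : (1 : Matrix n n ℝ) ⊗ₖ C ∈ W := Submodule.subset_span (by simp)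
  have hCC' : C ⊗ₖ C ∈ W := Submodule.subset_span (by simp)
  have hDD' : D ⊗ₖ D ∈ W := Submodule.subset_span (by simp)
  have neg_kronecker (X Y : Matrix n n ℝ) : (-X) ⊗ₖ Y = -(X ⊗ₖ Y) := by
    simpa using smul_kronecker (-1 : ℝ) X Y
  have kronecker_neg (X Y : Matrix n n ℝ) : X ⊗ₖ (-Y) = -(X ⊗ₖ Y) := by
    simpa using kronecker_smul (-1 : ℝ) X Y
  rintro _ ⟨X, hX, Y, hY, rfl⟩
  simp only [Set.mem_insert_iff, Set.mem_singleton_iff] at hX hY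
  rcases hX with rfl | rfl | rfl | rfl | rfl <;> rcases hY with rfl | rfl | rfl | rfl | rfl <;>
    simp only [SetLike.mem_coe, ← mul_kronecker_mul, mul_one, one_mul, hCC, hCD, hDC, hDD,
      sub_eq_add_neg, add_kronecker, kronecker_add, smul_kronecker, kronecker_smul,
      neg_kronecker, kronecker_neg] <;>
    apply_rules [W.add_mem, W.neg_mem, W.smul_mem]

theorem conference_rank5_fusion {ν : ℕ} (hν : 1 ≤ ν)
    (Γ : SimpleGraph (Fin (4 * ν + 1))) [DecidableRel Γ.Adj]
    (h : Γ.IsSRGWith (4 * ν + 1) (2 * ν) (ν - 1) ν) :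
    let A₀ : Matrix (Fin (4 * ν + 1)) (Fin (4 * ν + 1)) ℝ := 1
    let A₁ : Matrix (Fin (4 * ν + 1)) (Fin (4 * ν + 1)) ℝ := Γ.adjMatrix ℝ
    let J : Matrix (Fin (4 * ν + 1)) (Fin (4 * ν + 1)) ℝ := Matrix.of fun _ _ => 1
    let A₂ : Matrix (Fin (4 * ν + 1)) (Fin (4 * ν + 1)) ℝ := J - 1 - A₁
    let S : Set (Matrix (Fin (4 * ν + 1) × Fin (4 * ν + 1)) (Fin (4 * ν + 1) × Fin (4 * ν + 1)) ℝ) :=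
      {A₀ ⊗ₖ A₀, (J - A₀) ⊗ₖ A₀, A₀ ⊗ₖ (J - A₀), A₁ ⊗ₖ A₁ + A₂ ⊗ₖ A₂,
        A₂ ⊗ₖ A₁ + A₁ ⊗ₖ A₂}
    ∀ X ∈ Submodule.span ℝ S, ∀ Y ∈ Submodule.span ℝ S, X * Y ∈ Submodule.span ℝ S := by
  intro A₀ A₁ J A₂ S
  have hJJ : J * J = (4 * ν + 1 : ℝ) • J := by
    ext i j
    simp [J, Matrix.mul_apply]
  have hAJ : A₁ * J = (2 * ν : ℝ) • J := by
    ext i j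
    simp [J, A₁, SimpleGraph.adjMatrix_mul_apply, h.regular.degree_eq]
  have hJA : J * A₁ = (2 * ν : ℝ) • J := by
    ext i j
    simp [J, A₁, SimpleGraph.mul_adjMatrix_apply, h.regular.degree_eq]
  have hcompl : Γᶜ.adjMatrix ℝ = A₂ := by
    ext i j
    by_cases hij : i = j
    · simp [A₂, A₁, J, hij]
    · by_cases hadj : Γ.Adj i j <;>
        simp [A₂, A₁, J, hij, hadj, SimpleGraph.adjMatrix_apply]
  have hAA : A₁ * A₁ = (2 * ν : ℝ) • (1 : Matrix _ _ ℝ) + (ν - 1 : ℝ) • A₁ + (ν : ℝ) • A₂ := by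
    have := h.matrix_eq (α := ℝ)
    rw [hcompl, pow_two] at this
    simpa only [← Nat.cast_smul_eq_nsmul ℝ, Nat.cast_sub hν, Nat.cast_mul, Nat.cast_ofNat,
      Nat.cast_one] using this
  set C := J - A₀ with hC
  set D := A₁ - A₂ with hD
  have hspan : Submodule.span ℝ S =
      Submodule.span ℝ {(A₀ ⊗ₖ A₀), C ⊗ₖ A₀, A₀ ⊗ₖ C, C ⊗ₖ C, D ⊗ₖ D} := by
    have hA₁ : A₁ = (1 / 2 : ℝ) • (C + D) := by
      simp only [hC, hD, A₂, A₀]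
      module
    have hA₂ : A₂ = (1 / 2 : ℝ) • (C - D) := by
      simp only [hC, hD, A₂, A₀]
      module
    have hsame : A₁ ⊗ₖ A₁ + A₂ ⊗ₖ A₂ = (1 / 2 : ℝ) • C ⊗ₖ C + (1 / 2 : ℝ) • D ⊗ₖ D := by
      rw [hA₁, hA₂]
      ext ⟨i, i'⟩ ⟨j, j'⟩
      simp [kroneckerMap_apply]
      ring
    have hdiff : A₂ ⊗ₖ A₁ + A₁ ⊗ₖ A₂ = (1 / 2 : ℝ) • C ⊗ₖ C - (1 / 2 : ℝ) • D ⊗ₖ D := by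
      rw [hA₁, hA₂]
      ext ⟨i, i'⟩ ⟨j, j'⟩
      simp [kroneckerMap_apply]
      ring
    have hCC : C ⊗ₖ C = (A₁ ⊗ₖ A₁ + A₂ ⊗ₖ A₂) + (A₂ ⊗ₖ A₁ + A₁ ⊗ₖ A₂) := by
      rw [hsame, hdiff]
      module
    have hDD : D ⊗ₖ D = (A₁ ⊗ₖ A₁ + A₂ ⊗ₖ A₂) - (A₂ ⊗ₖ A₁ + A₁ ⊗ₖ A₂) := by
      rw [hsame, hdiff]
      module
    apply le_antisymm <;> rw [Submodule.span_le]
    · rintro _ (rfl | rfl | rfl | rfl | rfl)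
      · exact Submodule.subset_span (by simp)
      · exact Submodule.subset_span (by simp [hC])
      · exact Submodule.subset_span (by simp [hC])
      · rw [hsame]
        exact add_mem (Submodule.smul_mem _ _ (Submodule.subset_span (by simp)))
          (Submodule.smul_mem _ _ (Submodule.subset_span (by simp)))
      · rw [hdiff]
        exact sub_mem (Submodule.smul_mem _ _ (Submodule.subset_span (by simp)))
          (Submodule.smul_mem _ _ (Submodule.subset_span (by simp)))
    · rintro _ (rfl | rfl | rfl | rfl | rfl)
      · exact Submodule.subset_span (by simp [S])
      · exact Submodule.subset_span (by simp [S, hC])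
      · exact Submodule.subset_span (by simp [S, hC])
      · rw [hCC]
        exact add_mem (Submodule.subset_span (by simp [S])) (Submodule.subset_span (by simp [S]))
      · rw [hDD]
        exact sub_mem (Submodule.subset_span (by simp [S])) (Submodule.subset_span (by simp [S]))
  intro X hX Y hY
  rw [hspan] at hX hY ⊢
  refine span_kronecker_mul_le (a := 4 * ν) (b := 4 * ν - 1) ?_ ?_ ?_ ?_
    (Submodule.mul_mem_mul hX hY) <;>
  · simp only [hC, hD, A₂, A₀, mul_sub, sub_mul, mul_one, one_mul, hJJ, hAJ, hJA, hAA]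
    module
end

section
/- Let Γ be a conference graph: strongly regular with parameters (4ν+1, 2ν, ν-1, ν) for some ν ≥ 1. Then the six matrices {A₀⊗A₀, A₁⊗A₀ + A₀⊗A₂, A₂⊗A₀ + A₀⊗A₁, A₁⊗A₁ + A₂⊗A₂, A₂⊗A₁, A₁⊗A₂} span a fusion of the tensor square; that is, their ℝ-linear span is closed under matrix multiplication. (This is the rank-6 special case fusion with partition 27|34|59|6|8 of Theorem 4.3.) -/
open Matrix Kronecker

/-- Membership in the span of six vectors, given explicit coefficients. -/
theorem Submodule.mem_span_six {R M : Type*} [Semiring R] [AddCommMonoid M] [Module R M]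
    {p q s t u v x : M} (c₀ c₁ c₂ c₃ c₄ c₅ : R)
    (hx : x = c₀ • p + c₁ • q + c₂ • s + c₃ • t + c₄ • u + c₅ • v) :
    x ∈ Submodule.span R {p, q, s, t, u, v} := by
  subst hx
  refine add_mem (add_mem (add_mem (add_mem (add_mem ?_ ?_) ?_) ?_) ?_) ?_ <;>
    exact Submodule.smul_mem _ _ (Submodule.subset_span (by simp))

/-- The fusion of the tensor square of a rank three algebra with the structure constants of a
conference graph. -/
theorem kronecker_fusion_of_conference_relations {m : Type*} [Fintype m] [DecidableEq m]
    {A B : Matrix m m ℝ} {r : ℝ}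
    (hAA : A * A = (2 * r) • 1 + (r - 1) • A + r • B) (hAB : A * B = r • A + r • B)
    (hBA : B * A = r • A + r • B) (hBB : B * B = (2 * r) • 1 + r • A + (r - 1) • B)
    {W : Submodule ℝ (Matrix (m × m) (m × m) ℝ)}
    (hW : W = Submodule.span ℝ {(1 : Matrix m m ℝ) ⊗ₖ (1 : Matrix m m ℝ), A ⊗ₖ 1 + 1 ⊗ₖ B,
      B ⊗ₖ 1 + 1 ⊗ₖ A, A ⊗ₖ A + B ⊗ₖ B, B ⊗ₖ A, A ⊗ₖ B}) :
    ∀ X ∈ W, ∀ Y ∈ W, X * Y ∈ W := by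
  have hprod : (A ⊗ₖ 1 + 1 ⊗ₖ B) * (A ⊗ₖ 1 + 1 ⊗ₖ B) ∈ W ∧
      (A ⊗ₖ 1 + 1 ⊗ₖ B) * (B ⊗ₖ 1 + 1 ⊗ₖ A) ∈ W ∧
      (B ⊗ₖ 1 + 1 ⊗ₖ A) * (A ⊗ₖ 1 + 1 ⊗ₖ B) ∈ W ∧
      (A ⊗ₖ 1 + 1 ⊗ₖ B) * (A ⊗ₖ A + B ⊗ₖ B) ∈ W ∧
      (A ⊗ₖ A + B ⊗ₖ B) * (A ⊗ₖ 1 + 1 ⊗ₖ B) ∈ W ∧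
      (A ⊗ₖ 1 + 1 ⊗ₖ B) * (B ⊗ₖ A) ∈ W ∧
      (B ⊗ₖ A) * (A ⊗ₖ 1 + 1 ⊗ₖ B) ∈ W ∧
      (A ⊗ₖ 1 + 1 ⊗ₖ B) * (A ⊗ₖ B) ∈ W ∧
      (A ⊗ₖ B) * (A ⊗ₖ 1 + 1 ⊗ₖ B) ∈ W ∧
      (B ⊗ₖ 1 + 1 ⊗ₖ A) * (B ⊗ₖ 1 + 1 ⊗ₖ A) ∈ W ∧
      (B ⊗ₖ 1 + 1 ⊗ₖ A) * (A ⊗ₖ A + B ⊗ₖ B) ∈ W ∧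
      (A ⊗ₖ A + B ⊗ₖ B) * (B ⊗ₖ 1 + 1 ⊗ₖ A) ∈ W ∧
      (B ⊗ₖ 1 + 1 ⊗ₖ A) * (B ⊗ₖ A) ∈ W ∧
      (B ⊗ₖ A) * (B ⊗ₖ 1 + 1 ⊗ₖ A) ∈ W ∧
      (B ⊗ₖ 1 + 1 ⊗ₖ A) * (A ⊗ₖ B) ∈ W ∧
      (A ⊗ₖ B) * (B ⊗ₖ 1 + 1 ⊗ₖ A) ∈ W ∧
      (A ⊗ₖ A + B ⊗ₖ B) * (A ⊗ₖ A + B ⊗ₖ B) ∈ W ∧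
      (A ⊗ₖ A + B ⊗ₖ B) * (B ⊗ₖ A) ∈ W ∧
      (B ⊗ₖ A) * (A ⊗ₖ A + B ⊗ₖ B) ∈ W ∧
      (A ⊗ₖ A + B ⊗ₖ B) * (A ⊗ₖ B) ∈ W ∧
      (A ⊗ₖ B) * (A ⊗ₖ A + B ⊗ₖ B) ∈ W ∧
      (B ⊗ₖ A) * (B ⊗ₖ A) ∈ W ∧
      (B ⊗ₖ A) * (A ⊗ₖ B) ∈ W ∧
      (A ⊗ₖ B) * (B ⊗ₖ A) ∈ W ∧
      (A ⊗ₖ B) * (A ⊗ₖ B) ∈ W := by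
    rw [hW]
    refine ⟨Submodule.mem_span_six (4 * r) (r - 1) r 0 0 2 ?_,
      Submodule.mem_span_six 0 r r 1 0 0 ?_,
      Submodule.mem_span_six 0 r r 1 0 0 ?_,
      Submodule.mem_span_six 0 0 (2 * r) (2 * r - 1) (2 * r) (2 * r) ?_,
      Submodule.mem_span_six 0 0 (2 * r) (2 * r - 1) (2 * r) (2 * r) ?_,
      Submodule.mem_span_six 0 0 0 r (2 * r) 0 ?_,
      Submodule.mem_span_six 0 0 0 r (2 * r) 0 ?_,
      Submodule.mem_span_six 0 (2 * r) 0 r 0 (2 * r - 2) ?_,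
      Submodule.mem_span_six 0 (2 * r) 0 r 0 (2 * r - 2) ?_,
      Submodule.mem_span_six (4 * r) r (r - 1) 0 2 0 ?_,
      Submodule.mem_span_six 0 (2 * r) 0 (2 * r - 1) (2 * r) (2 * r) ?_,
      Submodule.mem_span_six 0 (2 * r) 0 (2 * r - 1) (2 * r) (2 * r) ?_,
      Submodule.mem_span_six 0 0 (2 * r) r (2 * r - 2) 0 ?_,
      Submodule.mem_span_six 0 0 (2 * r) r (2 * r - 2) 0 ?_,
      Submodule.mem_span_six 0 0 0 r 0 (2 * r) ?_,
      Submodule.mem_span_six 0 0 0 r 0 (2 * r) ?_,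
      Submodule.mem_span_six (8 * r ^ 2) (4 * r ^ 2 - 2 * r) (4 * r ^ 2 - 2 * r)
        (4 * r ^ 2 - 2 * r + 1) (4 * r ^ 2 - 2 * r) (4 * r ^ 2 - 2 * r) ?_,
      Submodule.mem_span_six 0 (2 * r ^ 2) (2 * r ^ 2) (2 * r ^ 2 - r) (2 * r ^ 2 - 2 * r)
        (2 * r ^ 2) ?_,
      Submodule.mem_span_six 0 (2 * r ^ 2) (2 * r ^ 2) (2 * r ^ 2 - r) (2 * r ^ 2 - 2 * r)
        (2 * r ^ 2) ?_,
      Submodule.mem_span_six 0 (2 * r ^ 2) (2 * r ^ 2) (2 * r ^ 2 - r) (2 * r ^ 2)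
        (2 * r ^ 2 - 2 * r) ?_,
      Submodule.mem_span_six 0 (2 * r ^ 2) (2 * r ^ 2) (2 * r ^ 2 - r) (2 * r ^ 2)
        (2 * r ^ 2 - 2 * r) ?_,
      Submodule.mem_span_six (4 * r ^ 2) (2 * r ^ 2) (2 * r ^ 2 - 2 * r) (r ^ 2 - r)
        (r ^ 2 - 2 * r + 1) (r ^ 2) ?_,
      Submodule.mem_span_six 0 0 0 (r ^ 2) (r ^ 2) (r ^ 2) ?_,
      Submodule.mem_span_six 0 0 0 (r ^ 2) (r ^ 2) (r ^ 2) ?_,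
      Submodule.mem_span_six (4 * r ^ 2) (2 * r ^ 2 - 2 * r) (2 * r ^ 2) (r ^ 2 - r) (r ^ 2)
        (r ^ 2 - 2 * r + 1) ?_⟩
    all_goals
      simp only [add_mul, mul_add, ← mul_kronecker_mul, one_mul, mul_one, hAA, hAB, hBA, hBB,
        add_kronecker, kronecker_add, smul_kronecker, kronecker_smul]
      module
  have hle : W * W ≤ W := by
    conv_lhs => rw [hW, Submodule.span_mul_span]
    rw [Submodule.span_le]
    rintro _ ⟨X, hX, Y, hY, rfl⟩
    have hXW : X ∈ W := hW ▸ Submodule.subset_span hX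
    have hYW : Y ∈ W := hW ▸ Submodule.subset_span hY
    simp only [Set.mem_insert_iff, Set.mem_singleton_iff, one_kronecker_one] at hX hY
    rcases hX with rfl | rfl | rfl | rfl | rfl | rfl
    · simpa using hYW
    all_goals
      rcases hY with rfl | rfl | rfl | rfl | rfl | rfl
      · simpa using hXW
      all_goals simp only [SetLike.mem_coe, hprod]
  exact fun X hX Y hY => hle (Submodule.mul_mem_mul hX hY)

theorem conference_rank6_fusion {ν : ℕ} (hν : 1 ≤ ν)
    (Γ : SimpleGraph (Fin (4 * ν + 1))) [DecidableRel Γ.Adj]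
    (h : Γ.IsSRGWith (4 * ν + 1) (2 * ν) (ν - 1) ν) :
    let A₀ : Matrix (Fin (4 * ν + 1)) (Fin (4 * ν + 1)) ℝ := 1
    let A₁ : Matrix (Fin (4 * ν + 1)) (Fin (4 * ν + 1)) ℝ := Γ.adjMatrix ℝ
    let J : Matrix (Fin (4 * ν + 1)) (Fin (4 * ν + 1)) ℝ := Matrix.of fun _ _ => 1
    let A₂ : Matrix (Fin (4 * ν + 1)) (Fin (4 * ν + 1)) ℝ := J - 1 - A₁
    let S : Set (Matrix (Fin (4 * ν + 1) × Fin (4 * ν + 1)) (Fin (4 * ν + 1) × Fin (4 * ν + 1)) ℝ) :=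
      {A₀ ⊗ₖ A₀, A₁ ⊗ₖ A₀ + A₀ ⊗ₖ A₂, A₂ ⊗ₖ A₀ + A₀ ⊗ₖ A₁, A₁ ⊗ₖ A₁ + A₂ ⊗ₖ A₂,
        A₂ ⊗ₖ A₁, A₁ ⊗ₖ A₂}
    ∀ X ∈ Submodule.span ℝ S, ∀ Y ∈ Submodule.span ℝ S, X * Y ∈ Submodule.span ℝ S := by
  intro A₀ A₁ J A₂ S
  have hcompl : Γᶜ.adjMatrix ℝ = A₂ := by
    ext i j
    by_cases hij : i = j
    · simp [A₂, J, A₁, hij]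
    · by_cases hadj : Γ.Adj i j <;> simp [A₂, J, A₁, hij, hadj]
  have hdeg : ∀ i, Γ.degree i = 2 * ν := h.regular
  have hAA : A₁ * A₁ = (2 * (ν : ℝ)) • 1 + ((ν : ℝ) - 1) • A₁ + (ν : ℝ) • A₂ := by
    have hsq := h.matrix_eq (α := ℝ)
    rw [hcompl, sq] at hsq
    simpa [← Nat.cast_smul_eq_nsmul ℝ, Nat.cast_sub hν] using hsq
  have hAJ : A₁ * J = (2 * (ν : ℝ)) • J := by
    ext i j
    simp [A₁, J, SimpleGraph.adjMatrix_mul_apply, hdeg]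
  have hJA : J * A₁ = (2 * (ν : ℝ)) • J := by
    ext i j
    simp [A₁, J, SimpleGraph.mul_adjMatrix_apply, hdeg]
  have hJJ : J * J = (4 * (ν : ℝ) + 1) • J := by
    ext i j
    simp [J, Matrix.mul_apply]
  have hJ : J = 1 + A₁ + A₂ := by simp only [A₂]; abel
  have hA₂ : A₂ = J - 1 - A₁ := rfl
  have hAB : A₁ * A₂ = (ν : ℝ) • A₁ + (ν : ℝ) • A₂ := by
    rw [hA₂, mul_sub, mul_sub, hAJ, hAA, mul_one, hJ]
    module
  have hBA : A₂ * A₁ = (ν : ℝ) • A₁ + (ν : ℝ) • A₂ := by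
    rw [hA₂, sub_mul, sub_mul, hJA, hAA, one_mul, hJ]
    module
  have hBB : A₂ * A₂ = (2 * (ν : ℝ)) • 1 + (ν : ℝ) • A₁ + ((ν : ℝ) - 1) • A₂ := by
    have hJB : J * A₂ = (2 * (ν : ℝ)) • J := by
      rw [hA₂, mul_sub, mul_sub, hJA, hJJ, mul_one]
      module
    have hexp : A₂ * A₂ = J * A₂ - A₂ - A₁ * A₂ := by
      nth_rewrite 1 [hA₂]
      rw [sub_mul, sub_mul, one_mul]
    rw [hexp, hJB, hAB, hJ]
    module
  exact kronecker_fusion_of_conference_relations hAA hAB hBA hBB rfl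
end

section
/- Let m ≥ 1 and let Γ be strongly regular with parameters ((m+1)², m², (m-1)², m² - m) (the complement of the Cartesian product of two complete graphs of order m+1; restricted eigenvalues r = 1 and s = -m). Then the five matrices {A₀⊗A₀, A₁⊗A₀ + A₀⊗A₁ + A₂⊗A₂, A₂⊗A₀ + A₀⊗A₂, A₁⊗A₁, A₂⊗A₁ + A₁⊗A₂} span a fusion of the tensor square; that is, their ℝ-linear span is closed under matrix multiplication. (This is the rank-5 special case fusion with partition 249|37|5|68 of Theorem 4.4(i).) -/
open Matrix Kronecker

theorem Submodule.mem_span_insert_five {R M : Type*} [Semiring R] [AddCommMonoid M] [Module R M]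
    {x₀ x₁ x₂ x₃ x₄ y : M} (c₀ c₁ c₂ c₃ c₄ : R)
    (h : y = c₀ • x₀ + c₁ • x₁ + c₂ • x₂ + c₃ • x₃ + c₄ • x₄) :
    y ∈ span R {x₀, x₁, x₂, x₃, x₄} := by
  subst h
  refine add_mem (add_mem (add_mem (add_mem ?_ ?_) ?_) ?_) ?_ <;>
    exact smul_mem _ _ (subset_span (by simp))

/-- The rank-5 symmetric fusion of the tensor square of a rank-3 algebra with basis `1, A, C` whose
structure constants are those of the complement of the `(m + 1) × (m + 1)` lattice graph. -/
theorem Matrix.kronecker_fusion_mul_mem_span {ι : Type*} [Fintype ι] [DecidableEq ι] (m : ℝ)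
    {A C : Matrix ι ι ℝ}
    (hAA : A * A = m ^ 2 • (1 : Matrix ι ι ℝ) + (m - 1) ^ 2 • A + (m ^ 2 - m) • C)
    (hAC : A * C = (2 * m - 2) • A + m • C) (hCA : C * A = (2 * m - 2) • A + m • C)
    (hCC : C * C = (2 * m) • (1 : Matrix ι ι ℝ) + (2 : ℝ) • A + (m - 1) • C)
    {X Y : Matrix (ι × ι) (ι × ι) ℝ}
    (hX : X ∈ Submodule.span ℝ {(1 : Matrix ι ι ℝ) ⊗ₖ (1 : Matrix ι ι ℝ),
      A ⊗ₖ 1 + 1 ⊗ₖ A + C ⊗ₖ C, C ⊗ₖ 1 + 1 ⊗ₖ C, A ⊗ₖ A, C ⊗ₖ A + A ⊗ₖ C})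
    (hY : Y ∈ Submodule.span ℝ {(1 : Matrix ι ι ℝ) ⊗ₖ (1 : Matrix ι ι ℝ),
      A ⊗ₖ 1 + 1 ⊗ₖ A + C ⊗ₖ C, C ⊗ₖ 1 + 1 ⊗ₖ C, A ⊗ₖ A, C ⊗ₖ A + A ⊗ₖ C}) :
    X * Y ∈ Submodule.span ℝ {(1 : Matrix ι ι ℝ) ⊗ₖ (1 : Matrix ι ι ℝ),
      A ⊗ₖ 1 + 1 ⊗ₖ A + C ⊗ₖ C, C ⊗ₖ 1 + 1 ⊗ₖ C, A ⊗ₖ A, C ⊗ₖ A + A ⊗ₖ C} := by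
  have hcomm : Commute A C := hAC.trans hCA.symm
  set B₁ := A ⊗ₖ (1 : Matrix ι ι ℝ) + (1 : Matrix ι ι ℝ) ⊗ₖ A + C ⊗ₖ C with hB₁
  set B₂ := C ⊗ₖ (1 : Matrix ι ι ℝ) + (1 : Matrix ι ι ℝ) ⊗ₖ C with hB₂
  set B₃ := A ⊗ₖ A with hB₃
  set B₄ := C ⊗ₖ A + A ⊗ₖ C with hB₄
  set P := Submodule.span ℝ {(1 : Matrix ι ι ℝ) ⊗ₖ (1 : Matrix ι ι ℝ), B₁, B₂, B₃, B₄} with hP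
  obtain ⟨h11, h12, h13, h14, h22, h23, h24, h33, h34, h44⟩ :
      B₁ * B₁ ∈ P ∧ B₁ * B₂ ∈ P ∧ B₁ * B₃ ∈ P ∧ B₁ * B₄ ∈ P ∧
      B₂ * B₂ ∈ P ∧ B₂ * B₃ ∈ P ∧ B₂ * B₄ ∈ P ∧ B₃ * B₃ ∈ P ∧
      B₃ * B₄ ∈ P ∧ B₄ * B₄ ∈ P := by
    refine ⟨Submodule.mem_span_insert_five (6 * m ^ 2) (m ^ 2 + 2 * m + 1) (3 * m ^ 2 - 3 * m) 6
        (6 * m - 6) ?_,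
      Submodule.mem_span_insert_five 0 (2 * m - 2) (3 * m) 0 3 ?_,
      Submodule.mem_span_insert_five 0 (m ^ 2) 0 (6 * m ^ 2 - 12 * m + 6) (3 * m ^ 2 - 3 * m) ?_,
      Submodule.mem_span_insert_five 0 (4 * m ^ 2 - 4 * m) (3 * m ^ 2) (12 * m - 12)
        (3 * m ^ 2 - 3 * m + 3) ?_,
      Submodule.mem_span_insert_five (4 * m) 2 (m - 1) 0 0 ?_,
      Submodule.mem_span_insert_five 0 0 0 (4 * m - 4) m ?_,
      Submodule.mem_span_insert_five 0 (2 * m) 0 4 (3 * m - 3) ?_,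
      Submodule.mem_span_insert_five (m ^ 4) (m ^ 4 - 2 * m ^ 3 + m ^ 2) (m ^ 4 - m ^ 3)
        (m ^ 4 - 4 * m ^ 3 + 6 * m ^ 2 - 4 * m + 1) (m ^ 4 - 3 * m ^ 3 + 3 * m ^ 2 - m) ?_,
      Submodule.mem_span_insert_five 0 (2 * m ^ 3 - 2 * m ^ 2) (m ^ 3)
        (4 * m ^ 3 - 12 * m ^ 2 + 12 * m - 4) (3 * m ^ 3 - 6 * m ^ 2 + 3 * m) ?_,
      Submodule.mem_span_insert_five (4 * m ^ 3) (2 * m ^ 3 - 2 * m ^ 2 + 2 * m)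
        (3 * m ^ 3 - 3 * m ^ 2) (12 * m ^ 2 - 24 * m + 12) (m ^ 3 + 3 * m ^ 2 - 3 * m - 1) ?_⟩
    all_goals
      simp only [hB₁, hB₂, hB₃, hB₄, add_mul, mul_add, ← mul_kronecker_mul, hAA, hAC, hCA, hCC,
        mul_one, one_mul, add_kronecker, kronecker_add, smul_kronecker, kronecker_smul]
      module
  obtain ⟨c12, c13, c14, c23, c24, c34⟩ :
      B₁ * B₂ = B₂ * B₁ ∧ B₁ * B₃ = B₃ * B₁ ∧ B₁ * B₄ = B₄ * B₁ ∧
      B₂ * B₃ = B₃ * B₂ ∧ B₂ * B₄ = B₄ * B₂ ∧ B₃ * B₄ = B₄ * B₃ := by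
    refine ⟨?_, ?_, ?_, ?_, ?_, ?_⟩ <;>
      simp only [hB₁, hB₂, hB₃, hB₄, add_mul, mul_add, ← mul_kronecker_mul, hcomm.eq, mul_one,
        one_mul] <;>
      abel
  have hmem : ∀ Z ∈ ({(1 : Matrix ι ι ℝ) ⊗ₖ (1 : Matrix ι ι ℝ), B₁, B₂, B₃, B₄} :
      Set (Matrix (ι × ι) (ι × ι) ℝ)), Z ∈ P := fun Z hZ => Submodule.subset_span hZ
  refine Submodule.mul_mem_span_of_forall_mul_mem (fun Z hZ W hW => ?_) hX hY
  have hZ' := hmem Z hZ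
  have hW' := hmem W hW
  have hone : (1 : Matrix ι ι ℝ) ⊗ₖ (1 : Matrix ι ι ℝ) = 1 := one_kronecker_one
  rw [← hP]
  clear_value B₁ B₂ B₃ B₄ P
  rcases hZ with rfl | rfl | rfl | rfl | rfl
  · rwa [hone, one_mul]
  all_goals
    rcases hW with rfl | rfl | rfl | rfl | rfl
    · rwa [hone, mul_one]
    all_goals
      first
      | assumption
      | (simp only [← c12, ← c13, ← c14, ← c23, ← c24, ← c34]; assumption)

theorem SimpleGraph.IsRegularOfDegree.adjMatrix_mul_of_one {V α : Type*} [Fintype V]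
    [NonAssocSemiring α] {G : SimpleGraph V} [DecidableRel G.Adj] {d : ℕ}
    (h : G.IsRegularOfDegree d) :
    G.adjMatrix α * Matrix.of (fun _ _ => 1) = (d : α) • Matrix.of (fun _ _ => 1) := by
  ext v w
  simp [Matrix.mul_apply, SimpleGraph.adjMatrix_apply, ← SimpleGraph.neighborFinset_eq_filter,
    h.degree_eq v]

theorem SimpleGraph.IsRegularOfDegree.of_one_mul_adjMatrix {V α : Type*} [Fintype V]
    [NonAssocSemiring α] {G : SimpleGraph V} [DecidableRel G.Adj] {d : ℕ}
    (h : G.IsRegularOfDegree d) :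
    Matrix.of (fun _ _ => 1) * G.adjMatrix α = (d : α) • Matrix.of (fun _ _ => 1) := by
  ext v w
  simp [Matrix.mul_apply, SimpleGraph.adjMatrix_apply, G.adj_comm _ w,
    ← SimpleGraph.neighborFinset_eq_filter, h.degree_eq w]

theorem latticeComplement_rank5_fusion {m : ℕ} (hm : 1 ≤ m)
    (Γ : SimpleGraph (Fin ((m + 1) ^ 2))) [DecidableRel Γ.Adj]
    (h : Γ.IsSRGWith ((m + 1) ^ 2) (m ^ 2) ((m - 1) ^ 2) (m ^ 2 - m)) :
    let A₀ : Matrix (Fin ((m + 1) ^ 2)) (Fin ((m + 1) ^ 2)) ℝ := 1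
    let A₁ : Matrix (Fin ((m + 1) ^ 2)) (Fin ((m + 1) ^ 2)) ℝ := Γ.adjMatrix ℝ
    let J : Matrix (Fin ((m + 1) ^ 2)) (Fin ((m + 1) ^ 2)) ℝ := Matrix.of fun _ _ => 1
    let A₂ : Matrix (Fin ((m + 1) ^ 2)) (Fin ((m + 1) ^ 2)) ℝ := J - 1 - A₁
    let S : Set (Matrix (Fin ((m + 1) ^ 2) × Fin ((m + 1) ^ 2)) (Fin ((m + 1) ^ 2) × Fin ((m + 1) ^ 2)) ℝ) :=
      {A₀ ⊗ₖ A₀, A₁ ⊗ₖ A₀ + A₀ ⊗ₖ A₁ + A₂ ⊗ₖ A₂, A₂ ⊗ₖ A₀ + A₀ ⊗ₖ A₂,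
        A₁ ⊗ₖ A₁, A₂ ⊗ₖ A₁ + A₁ ⊗ₖ A₂}
    ∀ X ∈ Submodule.span ℝ S, ∀ Y ∈ Submodule.span ℝ S, X * Y ∈ Submodule.span ℝ S := by
  intro A₀ A₁ J A₂ S X hX Y hY
  have hcompl : Γᶜ.adjMatrix ℝ = A₂ := by
    ext v w
    by_cases hvw : v = w <;> by_cases ha : Γ.Adj v w <;>
      simp_all [A₂, J, A₁, SimpleGraph.adjMatrix_apply]
  have hAA : A₁ * A₁ = (m : ℝ) ^ 2 • A₀ + ((m : ℝ) - 1) ^ 2 • A₁ + ((m : ℝ) ^ 2 - m) • A₂ := by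
    have hsq := h.matrix_eq (α := ℝ)
    rw [hcompl, sq (Γ.adjMatrix ℝ), ← Nat.cast_smul_eq_nsmul ℝ, ← Nat.cast_smul_eq_nsmul ℝ,
      ← Nat.cast_smul_eq_nsmul ℝ, Nat.cast_sub (Nat.le_self_pow two_ne_zero m)] at hsq
    push_cast [Nat.cast_sub hm] at hsq
    exact hsq
  have hAJ : A₁ * J = ((m : ℝ) ^ 2) • J := by
    simpa [J] using h.regular.adjMatrix_mul_of_one (α := ℝ)
  have hJA : J * A₁ = ((m : ℝ) ^ 2) • J := by
    simpa [J] using h.regular.of_one_mul_adjMatrix (α := ℝ)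
  have hJ : J = A₀ + A₁ + A₂ := by simp only [A₂, A₀]; abel
  have hJJ : J * J = (((m : ℝ) + 1) ^ 2) • J := by
    ext v w
    simp [J, Matrix.mul_apply]
  have hAC : A₁ * A₂ = (2 * (m : ℝ) - 2) • A₁ + (m : ℝ) • A₂ := by
    have : A₁ * A₂ = A₁ * J - A₁ - A₁ * A₁ := by simp only [A₂, mul_sub, mul_one]
    rw [this, hAJ, hAA, hJ]
    module
  have hCA : A₂ * A₁ = (2 * (m : ℝ) - 2) • A₁ + (m : ℝ) • A₂ := by
    have : A₂ * A₁ = J * A₁ - A₁ - A₁ * A₁ := by simp only [A₂, sub_mul, one_mul]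
    rw [this, hJA, hAA, hJ]
    module
  have hCC : A₂ * A₂ = (2 * (m : ℝ)) • A₀ + (2 : ℝ) • A₁ + ((m : ℝ) - 1) • A₂ := by
    have : A₂ * A₂ = J * J - J - J * A₁ - A₂ - A₁ * A₂ := by
      nth_rw 1 [show A₂ = J - 1 - A₁ from rfl]
      rw [sub_mul, sub_mul, one_mul, show J * A₂ = J * J - J - J * A₁ by
        simp only [A₂, mul_sub, mul_one]]
    rw [this, hJJ, hJA, hAC, hJ]
    module
  exact Matrix.kronecker_fusion_mul_mem_span (m : ℝ) hAA hAC hCA hCC hX hY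
end

section
/- Let m ≥ 2 and let Γ be strongly regular with parameters (m², 2(m-1), m-2, 2) (the Cartesian product of two complete graphs of order m, i.e., the rook's graph; restricted eigenvalues r = m-2 and s = -2). Then the five matrices {A₀⊗A₀, A₁⊗A₀ + A₀⊗A₁, A₂⊗A₀ + A₀⊗A₂ + A₁⊗A₁, A₂⊗A₁ + A₁⊗A₂, A₂⊗A₂} span a fusion of the tensor square; that is, their ℝ-linear span is closed under matrix multiplication. (This is the rank-5 special case fusion with partition 24|375|68|9 of Theorem 4.4(ii).) -/
open Matrix Kronecker

/-- The elements of an algebra whose left multiplication maps the submodule `W` into itself. -/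
def Submodule.leftStabilizer {R A : Type*} [CommSemiring R] [Semiring A] [Algebra R A]
    (W : Submodule R A) : Subalgebra R A where
  carrier := {Y | ∀ X ∈ W, Y * X ∈ W}
  mul_mem' hY hZ X hX := by
    rw [mul_assoc]
    exact hY _ (hZ X hX)
  add_mem' hY hZ X hX := by
    rw [add_mul]
    exact W.add_mem (hY X hX) (hZ X hX)
  algebraMap_mem' r X hX := by
    rw [← Algebra.smul_def]
    exact W.smul_mem r hX

/-- If multiplication by `b₁` acts on `1, b₁, b₂, b₃, b₄` through the intersection numbers of the
Hamming scheme `H(4, q)`, then the span of these elements is closed under multiplication. -/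
theorem mul_mem_span_of_hamming_recurrence {A : Type*} [Ring A] [Algebra ℝ A] (q : ℝ)
    {b₁ b₂ b₃ b₄ : A}
    (h₁ : b₁ * b₁ = (4 * (q - 1)) • (1 : A) + (q - 2) • b₁ + (2 : ℝ) • b₂)
    (h₂ : b₁ * b₂ = (3 * (q - 1)) • b₁ + (2 * (q - 2)) • b₂ + (3 : ℝ) • b₃)
    (h₃ : b₁ * b₃ = (2 * (q - 1)) • b₂ + (3 * (q - 2)) • b₃ + (4 : ℝ) • b₄)
    (h₄ : b₁ * b₄ = (q - 1) • b₃ + (4 * (q - 2)) • b₄)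
    {X Y : A} (hX : X ∈ Submodule.span ℝ {1, b₁, b₂, b₃, b₄})
    (hY : Y ∈ Submodule.span ℝ {1, b₁, b₂, b₃, b₄}) :
    X * Y ∈ Submodule.span ℝ {1, b₁, b₂, b₃, b₄} := by
  set W : Submodule ℝ A := Submodule.span ℝ {1, b₁, b₂, b₃, b₄} with hW
  have w₀ : (1 : A) ∈ W := Submodule.subset_span (by simp)
  have w₁ : b₁ ∈ W := Submodule.subset_span (by simp)
  have w₂ : b₂ ∈ W := Submodule.subset_span (by simp)
  have w₃ : b₃ ∈ W := Submodule.subset_span (by simp)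
  have w₄ : b₄ ∈ W := Submodule.subset_span (by simp)
  have t₁ : b₁ ∈ W.leftStabilizer := by
    intro Z hZ
    induction hZ using Submodule.span_induction with
    | mem Z hZ =>
      rcases hZ with rfl | rfl | rfl | rfl | rfl
      · rwa [mul_one]
      · rw [h₁]
        exact W.add_mem (W.add_mem (W.smul_mem _ w₀) (W.smul_mem _ w₁)) (W.smul_mem _ w₂)
      · rw [h₂]
        exact W.add_mem (W.add_mem (W.smul_mem _ w₁) (W.smul_mem _ w₂)) (W.smul_mem _ w₃)
      · rw [h₃]
        exact W.add_mem (W.add_mem (W.smul_mem _ w₂) (W.smul_mem _ w₃)) (W.smul_mem _ w₄)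
      · rw [h₄]
        exact W.add_mem (W.smul_mem _ w₃) (W.smul_mem _ w₄)
    | zero => simp
    | add Z Z' _ _ hZ hZ' =>
      rw [mul_add]
      exact W.add_mem hZ hZ'
    | smul c Z _ hZ =>
      rw [mul_smul_comm]
      exact W.smul_mem c hZ
  set T := W.leftStabilizer
  have t₂ : b₂ ∈ T := by
    have e : b₂ = (1 / 2 : ℝ) • (b₁ * b₁ - (4 * (q - 1)) • (1 : A) - (q - 2) • b₁) := by
      rw [h₁]
      module
    rw [e]
    exact T.smul_mem (T.sub_mem (T.sub_mem (T.mul_mem t₁ t₁) (T.smul_mem T.one_mem _))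
      (T.smul_mem t₁ _)) _
  have t₃ : b₃ ∈ T := by
    have e : b₃ = (1 / 3 : ℝ) • (b₁ * b₂ - (3 * (q - 1)) • b₁ - (2 * (q - 2)) • b₂) := by
      rw [h₂]
      module
    rw [e]
    exact T.smul_mem (T.sub_mem (T.sub_mem (T.mul_mem t₁ t₂) (T.smul_mem t₁ _))
      (T.smul_mem t₂ _)) _
  have t₄ : b₄ ∈ T := by
    have e : b₄ = (1 / 4 : ℝ) • (b₁ * b₃ - (2 * (q - 1)) • b₂ - (3 * (q - 2)) • b₃) := by
      rw [h₃]
      module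
    rw [e]
    exact T.smul_mem (T.sub_mem (T.sub_mem (T.mul_mem t₁ t₃) (T.smul_mem t₂ _))
      (T.smul_mem t₃ _)) _
  have hWT : W ≤ Subalgebra.toSubmodule T := by
    rw [hW, Submodule.span_le]
    rintro Z (rfl | rfl | rfl | rfl | rfl)
    exacts [T.one_mem, t₁, t₂, t₃, t₄]
  exact hWT hX Y hY

/-- If `A₁` and `A₂` satisfy the relations of the Hamming scheme `H(2, q)`, then the symmetrized
tensor square spans a matrix algebra. -/
theorem mul_mem_span_kronecker_of_hamming {V : Type*} [Fintype V] [DecidableEq V] (q : ℝ)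
    {A₁ A₂ : Matrix V V ℝ}
    (h₁₁ : A₁ * A₁ = (2 * (q - 1)) • (1 : Matrix V V ℝ) + (q - 2) • A₁ + (2 : ℝ) • A₂)
    (h₁₂ : A₁ * A₂ = (q - 1) • A₁ + (2 * (q - 2)) • A₂)
    {X Y : Matrix (V × V) (V × V) ℝ}
    (hX : X ∈ Submodule.span ℝ {(1 : Matrix V V ℝ) ⊗ₖ (1 : Matrix V V ℝ), A₁ ⊗ₖ 1 + 1 ⊗ₖ A₁,
      A₂ ⊗ₖ 1 + 1 ⊗ₖ A₂ + A₁ ⊗ₖ A₁, A₂ ⊗ₖ A₁ + A₁ ⊗ₖ A₂, A₂ ⊗ₖ A₂})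
    (hY : Y ∈ Submodule.span ℝ {(1 : Matrix V V ℝ) ⊗ₖ (1 : Matrix V V ℝ), A₁ ⊗ₖ 1 + 1 ⊗ₖ A₁,
      A₂ ⊗ₖ 1 + 1 ⊗ₖ A₂ + A₁ ⊗ₖ A₁, A₂ ⊗ₖ A₁ + A₁ ⊗ₖ A₂, A₂ ⊗ₖ A₂}) :
    X * Y ∈ Submodule.span ℝ {(1 : Matrix V V ℝ) ⊗ₖ (1 : Matrix V V ℝ), A₁ ⊗ₖ 1 + 1 ⊗ₖ A₁,
      A₂ ⊗ₖ 1 + 1 ⊗ₖ A₂ + A₁ ⊗ₖ A₁, A₂ ⊗ₖ A₁ + A₁ ⊗ₖ A₂, A₂ ⊗ₖ A₂} := by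
  rw [one_kronecker_one] at hX hY ⊢
  refine mul_mem_span_of_hamming_recurrence q ?_ ?_ ?_ ?_ hX hY
  all_goals
    simp only [Matrix.add_mul, Matrix.mul_add, ← mul_kronecker_mul, Matrix.one_mul,
      Matrix.mul_one, h₁₁, h₁₂, add_kronecker, kronecker_add, smul_kronecker, kronecker_smul,
      one_kronecker_one]
    module

theorem rook_rank5_fusion {m : ℕ} (hm : 2 ≤ m)
    (Γ : SimpleGraph (Fin (m ^ 2))) [DecidableRel Γ.Adj]
    (h : Γ.IsSRGWith (m ^ 2) (2 * (m - 1)) (m - 2) 2) :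
    let A₀ : Matrix (Fin (m ^ 2)) (Fin (m ^ 2)) ℝ := 1
    let A₁ : Matrix (Fin (m ^ 2)) (Fin (m ^ 2)) ℝ := Γ.adjMatrix ℝ
    let J : Matrix (Fin (m ^ 2)) (Fin (m ^ 2)) ℝ := Matrix.of fun _ _ => 1
    let A₂ : Matrix (Fin (m ^ 2)) (Fin (m ^ 2)) ℝ := J - 1 - A₁
    let S : Set (Matrix (Fin (m ^ 2) × Fin (m ^ 2)) (Fin (m ^ 2) × Fin (m ^ 2)) ℝ) :=
      {A₀ ⊗ₖ A₀, A₁ ⊗ₖ A₀ + A₀ ⊗ₖ A₁, A₂ ⊗ₖ A₀ + A₀ ⊗ₖ A₂ + A₁ ⊗ₖ A₁,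
        A₂ ⊗ₖ A₁ + A₁ ⊗ₖ A₂, A₂ ⊗ₖ A₂}
    ∀ X ∈ Submodule.span ℝ S, ∀ Y ∈ Submodule.span ℝ S, X * Y ∈ Submodule.span ℝ S := by
  intro A₀ A₁ J A₂ S X hX Y hY
  have hJ : J = 1 + A₁ + A₂ := by
    simp only [A₂]
    abel
  have hA₂ : Γᶜ.adjMatrix ℝ = A₂ := by
    ext i j
    by_cases hij : i = j
    · simp [A₂, A₁, J, hij]
    · by_cases ha : Γ.Adj i j <;> simp [A₂, A₁, J, hij, ha]
  have hk : ((2 * (m - 1) : ℕ) : ℝ) = 2 * ((m : ℝ) - 1) := by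
    push_cast [Nat.cast_sub (show 1 ≤ m by omega)]
    ring
  have hl : ((m - 2 : ℕ) : ℝ) = (m : ℝ) - 2 := by
    push_cast [Nat.cast_sub hm]
    ring
  have h₁₁ : A₁ * A₁ = (2 * ((m : ℝ) - 1)) • (1 : Matrix _ _ ℝ) + ((m : ℝ) - 2) • A₁
      + (2 : ℝ) • A₂ := by
    have e := h.matrix_eq (α := ℝ)
    rw [hA₂, sq (Γ.adjMatrix ℝ), ← Nat.cast_smul_eq_nsmul ℝ, ← Nat.cast_smul_eq_nsmul ℝ (m - 2),
      ← Nat.cast_smul_eq_nsmul ℝ 2, hk, hl] at e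
    exact_mod_cast e
  have h₁J : A₁ * J = (2 * ((m : ℝ) - 1)) • J := by
    ext i j
    rw [← hk, SimpleGraph.adjMatrix_mul_apply]
    simp [J, h.regular.degree_eq i]
  have h₁₂ : A₁ * A₂ = ((m : ℝ) - 1) • A₁ + (2 * ((m : ℝ) - 2)) • A₂ := by
    have e : A₁ * A₂ = A₁ * J - A₁ - A₁ * A₁ := by
      simp only [A₂, Matrix.mul_sub, Matrix.mul_one]
    rw [e, h₁J, h₁₁, hJ]
    module
  exact mul_mem_span_kronecker_of_hamming (m : ℝ) h₁₁ h₁₂ hX hY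
end

section
/- Let r ≥ 2 and let Γ be strongly regular with parameters (4r², r(2r+1), r² + r, r² + r) (restricted eigenvalues r and s = -r, with k = r(2r+1) and ℓ = (r-1)(2r+1); for r = 2 this is the complement of the Clebsch graph). Then the three matrices {A₀⊗A₀, A₁⊗A₀ + A₀⊗A₁ + A₂⊗A₁ + A₁⊗A₂, A₂⊗A₀ + A₀⊗A₂ + A₁⊗A₁ + A₂⊗A₂} span a fusion of the tensor square; that is, their ℝ-linear span is closed under matrix multiplication. (This is the rank-3 special case fusion with partition 2468|3579 of Theorem 4.7(i).) -/
open Matrix Kronecker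

/-- If `b ^ 2` lies in the span of `1` and `j`, and `j` is absorbed up to scalars by `b` and by
itself, then the span of `1`, `b` and `j - 1 - b` is closed under multiplication. -/
theorem mul_mem_span_of_quadratic {R A : Type*} [CommRing R] [Ring A] [Algebra R A]
    {b j : A} {α β d e : R} (hbb : b * b = α • (1 : A) + β • j) (hbj : b * j = d • j)
    (hjb : j * b = d • j) (hjj : j * j = e • j) {x y : A}
    (hx : x ∈ Submodule.span R {1, b, j - 1 - b}) (hy : y ∈ Submodule.span R {1, b, j - 1 - b}) :
    x * y ∈ Submodule.span R {1, b, j - 1 - b} := by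
  have h_one : (1 : A) ∈ Submodule.span R {1, b, j - 1 - b} := Submodule.subset_span (by simp)
  have h_b : b ∈ Submodule.span R {1, b, j - 1 - b} := Submodule.subset_span (by simp)
  have h_c : j - 1 - b ∈ Submodule.span R {1, b, j - 1 - b} := Submodule.subset_span (by simp)
  have h_j : j ∈ Submodule.span R {1, b, j - 1 - b} := by
    have := add_mem (add_mem h_c h_b) h_one
    rwa [show j - 1 - b + b + 1 = j by abel] at this
  have h_bb : b * b ∈ Submodule.span R {1, b, j - 1 - b} := by
    rw [hbb]
    exact add_mem (Submodule.smul_mem _ _ h_one) (Submodule.smul_mem _ _ h_j)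
  have h_bj : b * j ∈ Submodule.span R {1, b, j - 1 - b} := by
    rw [hbj]
    exact Submodule.smul_mem _ _ h_j
  have h_jb : j * b ∈ Submodule.span R {1, b, j - 1 - b} := by
    rw [hjb]
    exact Submodule.smul_mem _ _ h_j
  have h_jj : j * j ∈ Submodule.span R {1, b, j - 1 - b} := by
    rw [hjj]
    exact Submodule.smul_mem _ _ h_j
  induction hx, hy using Submodule.span_induction₂ with
  | mem_mem x y hx hy =>
    simp only [Set.mem_insert_iff, Set.mem_singleton_iff] at hx hy
    rcases hx with rfl | rfl | rfl <;> rcases hy with rfl | rfl | rfl <;>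
      try simp only [mul_sub, sub_mul, mul_one, one_mul]
    all_goals
      repeat' first | assumption | apply sub_mem
  | zero_left y hy => simp
  | zero_right x hx => simp
  | add_left x y z _ _ _ hxz hyz => rw [add_mul]; exact add_mem hxz hyz
  | add_right x y z _ _ _ hxy hxz => rw [mul_add]; exact add_mem hxy hxz
  | smul_left a x y _ _ hxy => rw [smul_mul_assoc]; exact Submodule.smul_mem _ _ hxy
  | smul_right a x y _ _ hxy => rw [mul_smul_comm]; exact Submodule.smul_mem _ _ hxy

theorem clebsch_family2_rank3_fusion {r : ℕ} (hr : 2 ≤ r)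
    (Γ : SimpleGraph (Fin (4 * r ^ 2))) [DecidableRel Γ.Adj]
    (h : Γ.IsSRGWith (4 * r ^ 2) (r * (2 * r + 1)) (r ^ 2 + r) (r ^ 2 + r)) :
    let A₀ : Matrix (Fin (4 * r ^ 2)) (Fin (4 * r ^ 2)) ℝ := 1
    let A₁ : Matrix (Fin (4 * r ^ 2)) (Fin (4 * r ^ 2)) ℝ := Γ.adjMatrix ℝ
    let J : Matrix (Fin (4 * r ^ 2)) (Fin (4 * r ^ 2)) ℝ := Matrix.of fun _ _ => 1
    let A₂ : Matrix (Fin (4 * r ^ 2)) (Fin (4 * r ^ 2)) ℝ := J - 1 - A₁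
    let S : Set (Matrix (Fin (4 * r ^ 2) × Fin (4 * r ^ 2)) (Fin (4 * r ^ 2) × Fin (4 * r ^ 2)) ℝ) :=
      {A₀ ⊗ₖ A₀, A₁ ⊗ₖ A₀ + A₀ ⊗ₖ A₁ + A₂ ⊗ₖ A₁ + A₁ ⊗ₖ A₂,
        A₂ ⊗ₖ A₀ + A₀ ⊗ₖ A₂ + A₁ ⊗ₖ A₁ + A₂ ⊗ₖ A₂}
    ∀ X ∈ Submodule.span ℝ S, ∀ Y ∈ Submodule.span ℝ S, X * Y ∈ Submodule.span ℝ S := by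
  intro A₀ A₁ J A₂ S
  have hJJ : J * J = (4 * (r : ℝ) ^ 2) • J := by
    ext i j
    simp [J, Matrix.mul_apply]
  have hAJ : A₁ * J = ((r : ℝ) * (2 * r + 1)) • J := by
    ext i j
    simp [J, A₁, h.regular i]
  have hJA : J * A₁ = ((r : ℝ) * (2 * r + 1)) • J := by
    ext i j
    simp [J, A₁, h.regular j]
  have hAA : A₁ * A₁ = ((r : ℝ) ^ 2) • (1 : Matrix _ _ ℝ) + ((r : ℝ) ^ 2 + r) • J := by
    have hsq := h.matrix_eq (α := ℝ)
    have hsum : (1 : Matrix _ _ ℝ) + A₁ + Γᶜ.adjMatrix ℝ = J := by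
      ext i j
      by_cases hij : i = j
      · simp [J, A₁, hij]
      · by_cases ha : Γ.Adj i j <;> simp [J, A₁, hij, ha]
    rw [← hsum, ← sq, hsq]
    simp only [← Nat.cast_smul_eq_nsmul ℝ]
    push_cast
    module
  have hB : A₁ ⊗ₖ A₀ + A₀ ⊗ₖ A₁ + A₂ ⊗ₖ A₁ + A₁ ⊗ₖ A₂
      = J ⊗ₖ A₁ + A₁ ⊗ₖ J - (2 : ℝ) • A₁ ⊗ₖ A₁ := by
    ext ⟨i, i'⟩ ⟨j, j'⟩
    simp only [A₂, A₀, Matrix.add_apply, Matrix.sub_apply, Matrix.smul_apply, kronecker_apply,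
      smul_eq_mul]
    ring
  have hC : A₂ ⊗ₖ A₀ + A₀ ⊗ₖ A₂ + A₁ ⊗ₖ A₁ + A₂ ⊗ₖ A₂
      = J ⊗ₖ J - 1 - (J ⊗ₖ A₁ + A₁ ⊗ₖ J - (2 : ℝ) • A₁ ⊗ₖ A₁) := by
    rw [← one_kronecker_one]
    ext ⟨i, i'⟩ ⟨j, j'⟩
    simp only [A₂, A₀, Matrix.add_apply, Matrix.sub_apply, Matrix.smul_apply, kronecker_apply,
      smul_eq_mul]
    ring
  intro X hX Y hY
  simp only [S, hB, hC, A₀, one_kronecker_one] at hX hY ⊢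
  refine mul_mem_span_of_quadratic (α := 4 * (r : ℝ) ^ 4)
    (β := 2 * (4 * (r : ℝ) ^ 2) * (r ^ 2 + r) + 2 * (r * (2 * r + 1)) ^ 2
      - 8 * (r * (2 * r + 1)) * (r ^ 2 + r) + 4 * (r ^ 2 + r) ^ 2)
    (d := 2 * (4 * (r : ℝ) ^ 2) * (r * (2 * r + 1)) - 2 * (r * (2 * r + 1)) ^ 2)
    (e := (4 * (r : ℝ) ^ 2) ^ 2) ?_ ?_ ?_ ?_ hX hY
  all_goals
    simp only [add_mul, mul_add, sub_mul, mul_sub, smul_mul_assoc, mul_smul_comm,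
      ← mul_kronecker_mul, hJJ, hAJ, hJA, hAA]
    try rw [← one_kronecker_one]
    ext ⟨i, i'⟩ ⟨j, j'⟩
    simp only [Matrix.add_apply, Matrix.sub_apply, Matrix.smul_apply, kronecker_apply,
      smul_eq_mul]
    ring
end
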